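/- Let f satisfy (H) with τ₋ = τ₊ =: τ and 0 < τ ≤ 1, and let Ω be an arbitrary bounded smooth domain in ℝⁿ with n ≤ 12. Then any sequence (u_m) of semistable solutions of (N_{λ_m}) satisfying the stability inequality obeys sup_m ‖u_m‖_{L^∞(Ω)} < a_f. -/

import Mathlib

open MeasureTheory Filter Topology Real Set

noncomputable section

/-- The Laplacian of a real-valued function on Euclidean space. -/
def lap {n : ℕ} (u : EuclideanSpace ℝ (Fin n) → ℝ) (x : EuclideanSpace ℝ (Fin n)) : ℝ :=
  ∑ i : Fin n, iteratedFDeriv ℝ 2 u x ![EuclideanSpace.single i (1:ℝ), EuclideanSpace.single i (1:ℝ)]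

/-- A bounded (smooth) domain. -/
def GoodDomain {n : ℕ} (Ω : Set (EuclideanSpace ℝ (Fin n))) : Prop :=
  IsOpen Ω ∧ Bornology.IsBounded Ω ∧ Ω.Nonempty

/-- The domain `[0, a_f)` of the nonlinearity. -/
def domf (a : EReal) : Set ℝ := {t : ℝ | 0 ≤ t ∧ (t : EReal) < a}

/-- The filter of `t → a_f⁻`. -/
def afFilter (a : EReal) : Filter ℝ :=
  if a = ⊤ then Filter.atTop else nhdsWithin a.toReal (Set.Iio a.toReal)

/-- Hypothesis (H) on the nonlinearity `f : [0, a_f) → ℝ₊`. -/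
structure HypH (a : EReal) (f : ℝ → ℝ) : Prop where
  a_pos : 0 < a
  smooth : ContDiffOn ℝ (⊤ : ℕ∞) f (domf a)
  mono : StrictMonoOn f (domf a)
  convex : ConvexOn ℝ (domf a) f
  f0_pos : 0 < f 0
  pos : ∀ t ∈ domf a, 0 < f t
  blowup : Filter.Tendsto f (afFilter a) Filter.atTop
  superlinear : a = ⊤ → Filter.Tendsto (fun t => f t / t) Filter.atTop Filter.atTop

/-- `τ₋ = liminf_{t → a_f} f f'' / (f')²`. -/
def tauMinus (a : EReal) (f : ℝ → ℝ) : ℝ :=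
  Filter.liminf (fun t => f t * deriv (deriv f) t / (deriv f t) ^ 2) (afFilter a)

/-- `τ₊ = limsup_{t → a_f} f f'' / (f')²`. -/
def tauPlus (a : EReal) (f : ℝ → ℝ) : ℝ :=
  Filter.limsup (fun t => f t * deriv (deriv f) t / (deriv f t) ^ 2) (afFilter a)

/-- `u` is a (smooth, `[0,a_f)`-valued) solution of `Δ²u = λ f(u)` in `Ω`,
`u = Δu = 0` on `∂Ω`. -/
def Solves {n : ℕ} (Ω : Set (EuclideanSpace ℝ (Fin n))) (a : EReal) (lam : ℝ)
    (f : ℝ → ℝ) (u : EuclideanSpace ℝ (Fin n) → ℝ) : Prop :=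
  ContDiff ℝ (⊤ : ℕ∞) u ∧ (∀ x ∈ Ω, 0 ≤ u x ∧ (u x : EReal) < a) ∧
  (∀ x ∈ Ω, lap (lap u) x = lam * f (u x)) ∧
  (∀ x ∈ frontier Ω, u x = 0) ∧ (∀ x ∈ frontier Ω, lap u x = 0)

/-- `u` is a semistable solution: the second variation is nonnegative over
test functions in `H² ∩ H¹₀` (modelled by smooth functions vanishing on `∂Ω`). -/
def Semistable {n : ℕ} (Ω : Set (EuclideanSpace ℝ (Fin n))) (lam : ℝ)
    (f : ℝ → ℝ) (u : EuclideanSpace ℝ (Fin n) → ℝ) : Prop :=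
  ∀ φ : EuclideanSpace ℝ (Fin n) → ℝ, ContDiff ℝ (⊤ : ℕ∞) φ → (∀ x ∈ frontier Ω, φ x = 0) →
    0 ≤ ∫ x in Ω, ((lap φ x) ^ 2 - lam * deriv f (u x) * (φ x) ^ 2)

/-- `u` satisfies the stability inequality
`√λ ∫ √(f'(u)) φ² ≤ ∫ |∇φ|²` for all `φ ∈ H¹₀(Ω)`
(modelled by smooth compactly supported test functions). -/
def StabIneq {n : ℕ} (Ω : Set (EuclideanSpace ℝ (Fin n))) (lam : ℝ)
    (f : ℝ → ℝ) (u : EuclideanSpace ℝ (Fin n) → ℝ) : Prop :=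
  ∀ φ : EuclideanSpace ℝ (Fin n) → ℝ, ContDiff ℝ (⊤ : ℕ∞) φ → HasCompactSupport φ →
    tsupport φ ⊆ Ω →
    Real.sqrt lam * ∫ x in Ω, Real.sqrt (deriv f (u x)) * (φ x) ^ 2 ≤
      ∫ x in Ω, ‖gradient φ x‖ ^ 2

/-- The quartic polynomial `P_f(α, τ₋, τ₊)`. -/
def Pf (τm τp α : ℝ) : ℝ :=
  (2 - τm) ^ 2 * α ^ 4 - 8 * (2 - τp) * α ^ 2 + 4 * (4 - 3 * τp) * α - 4 * (1 - τp)

/-- `F(t) = ∫₀ᵗ f(s) ds`. -/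
def Fint (f : ℝ → ℝ) (t : ℝ) : ℝ := ∫ s in (0:ℝ)..t, f s

/-- `f̃(t) = f(t) - f(0)`. -/
def ftil (f : ℝ → ℝ) (t : ℝ) : ℝ := f t - f 0

/-- `Θ(t) = ∫₀ᵗ θ'(s)² ds`. -/
def Theta (θ : ℝ → ℝ) (t : ℝ) : ℝ := ∫ s in (0:ℝ)..t, (deriv θ s) ^ 2

lemma lap_eq {n : ℕ} (u : EuclideanSpace ℝ (Fin n) → ℝ) (hu : ContDiff ℝ (⊤ : ℕ∞) u)
    (x : EuclideanSpace ℝ (Fin n)) :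
    lap u x = ∑ i : Fin n, fderiv ℝ (fun y => fderiv ℝ u y (EuclideanSpace.single i (1:ℝ))) x
      (EuclideanSpace.single i (1:ℝ)) := by
  unfold lap
  refine Finset.sum_congr rfl fun i _ => ?_
  rw [iteratedFDeriv_two_apply]
  have h1 : DifferentiableAt ℝ (fderiv ℝ u) x :=
    ((hu.fderiv_right (m := 1) (by norm_cast)).differentiable (by norm_num)) x
  rw [fderiv_clm_apply h1 (differentiableAt_const _)]
  simp

lemma contDiff_lap {n : ℕ} (u : EuclideanSpace ℝ (Fin n) → ℝ) (hu : ContDiff ℝ (⊤ : ℕ∞) u) :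
    ContDiff ℝ (⊤ : ℕ∞) (lap u) := by
  have : lap u = fun x => ∑ i : Fin n, fderiv ℝ (fun y => fderiv ℝ u y
      (EuclideanSpace.single i (1:ℝ))) x (EuclideanSpace.single i (1:ℝ)) := by
    ext x; exact lap_eq u hu x
  rw [this]
  refine ContDiff.sum fun i _ => ?_
  have h1 : ContDiff ℝ (⊤ : ℕ∞) (fun y => fderiv ℝ u y (EuclideanSpace.single i (1:ℝ))) :=
    (hu.fderiv_right (m := (⊤ : ℕ∞)) (by norm_cast)).clm_apply contDiff_const
  exact (h1.fderiv_right (m := (⊤ : ℕ∞)) (by norm_cast)).clm_apply contDiff_const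

/-- truncated composition is a valid test function -/
lemma ind_smooth {n : ℕ} {Ω : Set (EuclideanSpace ℝ (Fin n))} (hΩ : IsOpen Ω)
    (hb : Bornology.IsBounded Ω) {W : EuclideanSpace ℝ (Fin n) → ℝ}
    (hW : ContDiff ℝ (⊤ : ℕ∞) W) (hWf : ∀ x ∈ frontier Ω, W x = 0) {D : Set ℝ} (hD : IsOpen D)
    (hWD : ∀ x ∈ Ω, W x ∈ D) {θ : ℝ → ℝ} (hθ : ContDiffOn ℝ (⊤ : ℕ∞) θ D) {t1 : ℝ}
    (ht1 : 0 < t1) (h0 : ∀ t ≤ t1, θ t = 0) :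
    ContDiff ℝ (⊤ : ℕ∞) (Ω.indicator (fun x => θ (W x))) ∧
    HasCompactSupport (Ω.indicator (fun x => θ (W x))) ∧
    tsupport (Ω.indicator (fun x => θ (W x))) ⊆ Ω := by
  set K : Set (EuclideanSpace ℝ (Fin n)) := closure Ω ∩ {x | t1 ≤ W x} with hK
  have hKc : IsCompact K :=
    hb.isCompact_closure.inter_right (isClosed_le continuous_const hW.continuous)
  have hKΩ : K ⊆ Ω := by
    rintro x ⟨hx, hx2⟩
    by_contra hxn
    have : x ∈ frontier Ω := by
      rw [frontier, hΩ.interior_eq]; exact ⟨hx, hxn⟩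
    have := hWf x this
    simp only [Set.mem_ofPred_eq] at hx2
    linarith
  have hts : tsupport (Ω.indicator (fun x => θ (W x))) ⊆ K := by
    refine closure_minimal ?_ hKc.isClosed
    intro x hx
    have hxΩ : x ∈ Ω := by
      by_contra hxn
      exact hx (indicator_of_notMem hxn _)
    refine ⟨subset_closure hxΩ, ?_⟩
    by_contra hlt
    apply hx
    rw [indicator_of_mem hxΩ]
    exact h0 _ (not_le.1 hlt).le
  refine ⟨?_, ?_, hts.trans hKΩ⟩
  · rw [contDiff_iff_contDiffAt]
    intro x
    by_cases hx : x ∈ Ω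
    · have h1 : ContDiffAt ℝ (⊤ : ℕ∞) (fun x => θ (W x)) x :=
        (hθ.contDiffAt (hD.mem_nhds (hWD x hx))).comp x hW.contDiffAt
      refine h1.congr_of_eventuallyEq ?_
      filter_upwards [hΩ.mem_nhds hx] with y hy
      rw [indicator_of_mem hy]
    · have h1 : x ∉ tsupport (Ω.indicator (fun x => θ (W x))) := fun h => hx (hKΩ (hts h))
      rw [notMem_tsupport_iff_eventuallyEq] at h1
      exact contDiffAt_const.congr_of_eventuallyEq h1
  · exact hKc.of_isClosed_subset (isClosed_tsupport _) hts

lemma norm_gradient_sq {n : ℕ} (φ : EuclideanSpace ℝ (Fin n) → ℝ) (x : EuclideanSpace ℝ (Fin n)) :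
    ‖gradient φ x‖ ^ 2 = ∑ i : Fin n, (fderiv ℝ φ x (EuclideanSpace.single i (1:ℝ))) ^ 2 := by
  rw [EuclideanSpace.norm_sq_eq]
  refine Finset.sum_congr rfl fun i _ => ?_
  have : gradient φ x i = fderiv ℝ φ x (EuclideanSpace.single i (1:ℝ)) := by
    have h := InnerProductSpace.toDual_symm_apply (𝕜 := ℝ) (x := EuclideanSpace.single i (1:ℝ))
      (y := fderiv ℝ φ x)
    rw [← h]
    rw [EuclideanSpace.inner_single_right]
    simp [gradient]
  rw [this, Real.norm_eq_abs, sq_abs]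

lemma energy_identity {n : ℕ} {Ω : Set (EuclideanSpace ℝ (Fin n))} (hΩ : IsOpen Ω)
    (hb : Bornology.IsBounded Ω) {W : EuclideanSpace ℝ (Fin n) → ℝ}
    (hW : ContDiff ℝ (⊤ : ℕ∞) W) (hWf : ∀ x ∈ frontier Ω, W x = 0) {D : Set ℝ} (hD : IsOpen D)
    (hWD : ∀ x ∈ Ω, W x ∈ D) {θ Θ : ℝ → ℝ} (hθ : ContDiffOn ℝ (⊤ : ℕ∞) θ D)
    (hΘ : ContDiffOn ℝ (⊤ : ℕ∞) Θ D) {t1 : ℝ}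
    (ht1 : 0 < t1) (h0 : ∀ t ≤ t1, θ t = 0) (h0' : ∀ t ≤ t1, Θ t = 0)
    (hder : ∀ t ∈ D, HasDerivAt Θ ((deriv θ t) ^ 2) t) :
    ∫ x in Ω, ‖gradient (Ω.indicator (fun x => θ (W x))) x‖ ^ 2 =
      ∫ x in Ω, Θ (W x) * (- lap W x) := by
  obtain ⟨hφ, -, -⟩ := ind_smooth hΩ hb hW hWf hD hWD hθ ht1 h0
  obtain ⟨hψ, hψc, hψs⟩ := ind_smooth hΩ hb hW hWf hD hWD hΘ ht1 h0'
  set φ := Ω.indicator (fun x => θ (W x)) with hφd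
  set ψ := Ω.indicator (fun x => Θ (W x)) with hψd
  let e : Fin n → EuclideanSpace ℝ (Fin n) := fun i => EuclideanSpace.single i (1:ℝ)
  have hWdiff : Differentiable ℝ W := hW.differentiable (by simp)
  have key : ∀ x ∈ Ω, ‖gradient φ x‖ ^ 2 = ∑ i, fderiv ℝ W x (e i) * fderiv ℝ ψ x (e i) := by
    intro x hx
    rw [norm_gradient_sq]
    have hWx := hWD x hx
    have e1 : HasFDerivAt φ (deriv θ (W x) • fderiv ℝ W x) x := by
      have hd : HasDerivAt θ (deriv θ (W x)) (W x) :=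
        ((hθ.contDiffAt (hD.mem_nhds hWx)).differentiableAt (by simp)).hasDerivAt
      refine (hd.comp_hasFDerivAt x (hWdiff x).hasFDerivAt).congr_of_eventuallyEq ?_
      filter_upwards [hΩ.mem_nhds hx] with y hy
      rw [hφd, indicator_of_mem hy]; rfl
    have e2 : HasFDerivAt ψ ((deriv θ (W x)) ^ 2 • fderiv ℝ W x) x := by
      refine ((hder _ hWx).comp_hasFDerivAt x (hWdiff x).hasFDerivAt).congr_of_eventuallyEq ?_
      filter_upwards [hΩ.mem_nhds hx] with y hy
      rw [hψd, indicator_of_mem hy]; rfl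
    rw [e1.fderiv, e2.fderiv]
    refine Finset.sum_congr rfl fun i _ => ?_
    simp [e]; ring
  have hWe : ∀ i, ContDiff ℝ (⊤ : ℕ∞) (fun x => fderiv ℝ W x (e i)) := fun i =>
    (hW.fderiv_right (m := (⊤ : ℕ∞)) (by norm_cast)).clm_apply contDiff_const
  have hψe : ∀ i, ContDiff ℝ (⊤ : ℕ∞) (fun x => fderiv ℝ ψ x (e i)) := fun i =>
    (hψ.fderiv_right (m := (⊤ : ℕ∞)) (by norm_cast)).clm_apply contDiff_const
  have hψec : ∀ i, HasCompactSupport (fun x => fderiv ℝ ψ x (e i)) := fun i =>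
    hψc.fderiv_apply (𝕜 := ℝ) (e i)
  have hint1 : ∀ i, Integrable (fun x => fderiv ℝ W x (e i) * fderiv ℝ ψ x (e i)) := fun i =>
    ((hWe i).continuous.mul (hψe i).continuous).integrable_of_hasCompactSupport (hψec i).mul_left
  have hWee : ∀ i, Continuous (fun x => fderiv ℝ (fun y => fderiv ℝ W y (e i)) x (e i)) := fun i =>
    (((hWe i).fderiv_right (m := (⊤ : ℕ∞)) (by norm_cast)).clm_apply contDiff_const).continuous
  have hint2 : ∀ i, Integrable (fun x => fderiv ℝ (fun y => fderiv ℝ W y (e i)) x (e i) * ψ x) :=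
    fun i => ((hWee i).mul hψ.continuous).integrable_of_hasCompactSupport hψc.mul_left
  have ibp : ∀ i, ∫ x, fderiv ℝ W x (e i) * fderiv ℝ ψ x (e i) =
      - ∫ x, fderiv ℝ (fun y => fderiv ℝ W y (e i)) x (e i) * ψ x := fun i => by
    refine integral_mul_fderiv_eq_neg_fderiv_mul_of_integrable (hint2 i) (hint1 i) ?_ ?_ ?_
    · exact ((hWe i).continuous.mul hψ.continuous).integrable_of_hasCompactSupport hψc.mul_left
    · exact fun x _ => (hWe i).differentiable (by simp) x
    · exact fun x _ => hψ.differentiable (by simp) x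
  calc ∫ x in Ω, ‖gradient φ x‖ ^ 2
      = ∫ x in Ω, ∑ i, fderiv ℝ W x (e i) * fderiv ℝ ψ x (e i) :=
        setIntegral_congr_fun hΩ.measurableSet key
    _ = ∫ x, ∑ i, fderiv ℝ W x (e i) * fderiv ℝ ψ x (e i) := by
        refine setIntegral_eq_integral_of_forall_compl_eq_zero fun x hx => ?_
        refine Finset.sum_eq_zero fun i _ => ?_
        have : fderiv ℝ ψ x = 0 := by
          by_contra hne
          exact hx (hψs (support_fderiv_subset ℝ hne))
        simp [this]
    _ = ∑ i, ∫ x, fderiv ℝ W x (e i) * fderiv ℝ ψ x (e i) :=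
        integral_finsetSum _ fun i _ => hint1 i
    _ = - ∑ i, ∫ x, fderiv ℝ (fun y => fderiv ℝ W y (e i)) x (e i) * ψ x := by
        rw [← Finset.sum_neg_distrib]; exact Finset.sum_congr rfl fun i _ => ibp i
    _ = - ∫ x, ∑ i, fderiv ℝ (fun y => fderiv ℝ W y (e i)) x (e i) * ψ x := by
        rw [integral_finsetSum _ fun i _ => hint2 i]
    _ = ∫ x, ψ x * (- lap W x) := by
        rw [← integral_neg]
        refine integral_congr_ae (Eventually.of_forall fun x => ?_)
        simp only [lap_eq W hW, ← Finset.sum_mul]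
        ring
    _ = ∫ x in Ω, ψ x * (- lap W x) := by
        refine (setIntegral_eq_integral_of_forall_compl_eq_zero fun x hx => ?_).symm
        rw [hψd, indicator_of_notMem hx, zero_mul]
    _ = ∫ x in Ω, Θ (W x) * (- lap W x) := by
        refine setIntegral_congr_fun hΩ.measurableSet fun x hx => ?_
        simp only [hψd, indicator_of_mem hx]

lemma norm_gradient_eq {n : ℕ} (φ : EuclideanSpace ℝ (Fin n) → ℝ) (x : EuclideanSpace ℝ (Fin n)) :
    ‖gradient φ x‖ = ‖fderiv ℝ φ x‖ := by
  simp [gradient]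

/-- One-dimensional sup bound. -/
lemma sob_dim_one {φ : EuclideanSpace ℝ (Fin 1) → ℝ} (hφ : ContDiff ℝ (⊤ : ℕ∞) φ) (hc : HasCompactSupport φ)
    (x : EuclideanSpace ℝ (Fin 1)) :
    ‖φ x‖ ≤ ∫ y, ‖fderiv ℝ φ y‖ := by
  let e : EuclideanSpace ℝ (Fin 1) := EuclideanSpace.single 0 (1:ℝ)
  have hn : ‖e‖ = 1 := by simp [e]
  have mp : MeasurePreserving (fun t : ℝ => t • e) volume volume := by
    have h1 := (volume_preserving_funUnique (Fin 1) ℝ).symm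
    have h2 := (EuclideanSpace.volume_preserving_symm_measurableEquiv_toLp (Fin 1)).symm
    have h3 := h2.comp h1
    have h4 : (fun t : ℝ => t • e) = ((MeasurableEquiv.toLp 2 (Fin 1 → ℝ)).symm.symm ∘
        (MeasurableEquiv.funUnique (Fin 1) ℝ).symm) := by
      funext t
      apply PiLp.ext
      intro i
      fin_cases i
      simp [e, MeasurableEquiv.funUnique]
    rw [h4]
    exact h3
  let L : ℝ →L[ℝ] EuclideanSpace ℝ (Fin 1) := (ContinuousLinearMap.id ℝ ℝ).smulRight e
  have hxe : ∀ y : EuclideanSpace ℝ (Fin 1), y = (y 0) • e := by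
    intro y; ext i; fin_cases i; simp [e]
  have hemb : MeasurableEmbedding (fun t : ℝ => t • e) := by
    refine Continuous.measurableEmbedding (by fun_prop) ?_
    intro s t hst
    have := congrArg (fun y : EuclideanSpace ℝ (Fin 1) => y 0) hst
    simpa [e] using this
  set g : ℝ → ℝ := fun t => φ (t • e) with hg
  have hgd : ∀ t, HasDerivAt g (fderiv ℝ φ (t • e) e) t := by
    intro t
    have h1 : HasDerivAt (fun t : ℝ => t • e) e t := by
      simpa using (hasDerivAt_id t).smul_const e
    exact ((hφ.differentiable (by simp) (t • e)).hasFDerivAt).comp_hasDerivAt t h1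
  have hcont : Continuous (fun y => fderiv ℝ φ y) := hφ.continuous_fderiv (by simp)
  have hint : Integrable (fun y => ‖fderiv ℝ φ y‖) :=
    hcont.norm.integrable_of_hasCompactSupport (hc.fderiv (𝕜 := ℝ)).norm
  have hint' : Integrable (fun t : ℝ => ‖fderiv ℝ φ (t • e)‖) :=
    (mp.integrable_comp_emb hemb).2 hint
  have hder_int : Integrable (fun t : ℝ => fderiv ℝ φ (t • e) e) := by
    refine hint'.mono' ?_ (Eventually.of_forall fun t => ?_)
    · exact Continuous.aestronglyMeasurable (by fun_prop)
    · have := (fderiv ℝ φ (t • e)).le_opNorm e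
      simpa [hn] using this
  have hlim : Tendsto g atBot (𝓝 0) := by
    have hgc : HasCompactSupport g := by
      have : IsClosedEmbedding (fun t : ℝ => t • e) :=
        isClosedEmbedding_smul_left (by intro h; simp [h] at hn)
      exact hc.comp_isClosedEmbedding this
    exact (hgc.is_zero_at_infty).mono_left atBot_le_cocompact
  have hftc := integral_Iic_of_hasDerivAt_of_tendsto' (a := x 0) (fun t _ => hgd t)
    hder_int.integrableOn hlim
  have hgx : g (x 0) = φ x := by rw [hg]; simp only; rw [← hxe x]
  rw [sub_zero, hgx] at hftc
  rw [← hftc]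
  calc ‖∫ t in Iic (x 0), fderiv ℝ φ (t • e) e‖ ≤ ∫ t in Iic (x 0), ‖fderiv ℝ φ (t • e)‖ := by
        refine norm_integral_le_of_norm_le hint'.integrableOn (Eventually.of_forall fun t => ?_)
        have := (fderiv ℝ φ (t • e)).le_opNorm e
        simpa [hn] using this
    _ ≤ ∫ t, ‖fderiv ℝ φ (t • e)‖ :=
        setIntegral_le_integral hint' (Eventually.of_forall fun t => norm_nonneg _)
    _ = ∫ y, ‖fderiv ℝ φ y‖ := mp.integral_comp hemb (fun y => ‖fderiv ℝ φ y‖)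

lemma eLp_restr {α F : Type*} [MeasurableSpace α] {μ : Measure α} [NormedAddCommGroup F]
    (g : α → F) (p : ENNReal) {Ω : Set α} (h : ∀ x, x ∉ Ω → ‖g x‖ = 0) :
    eLpNorm g p (μ.restrict Ω) = eLpNorm g p μ := by
  refine eLpNorm_restrict_eq_of_support_subset ?_
  intro x hx
  by_contra hn
  exact hx (norm_eq_zero.1 (h x hn))

lemma sob_eLp {n : ℕ} (hn1 : 1 ≤ n) (hn : n ≤ 12) {Ω : Set (EuclideanSpace ℝ (Fin n))}
    (hb : Bornology.IsBounded Ω) (hm : MeasurableSet Ω) :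
    ∃ C : NNReal, ∀ φ : EuclideanSpace ℝ (Fin n) → ℝ, ContDiff ℝ (⊤ : ℕ∞) φ →
      HasCompactSupport φ → tsupport φ ⊆ Ω →
      eLpNorm φ ((12/5 : NNReal) : ENNReal) (volume.restrict Ω) ≤
        C * eLpNorm (fderiv ℝ φ) 2 (volume.restrict Ω) := by
  have hfin : volume Ω < ⊤ := hb.measure_lt_top
  have : IsFiniteMeasure (volume.restrict Ω) := ⟨by simpa using hfin⟩
  rcases Nat.lt_or_ge 1 n with h2 | h1
  · have hn0 : (0:ℝ) < n := by exact_mod_cast hn1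
    obtain ⟨p, hp⟩ : ∃ p : NNReal, p = (5/12 + (n:NNReal)⁻¹)⁻¹ := ⟨_, rfl⟩
    have hpinv : p⁻¹ = 5/12 + (n:NNReal)⁻¹ := by rw [hp, inv_inv]
    have hn0' : (0:NNReal) < n := by exact_mod_cast hn1
    have hp1 : 1 ≤ p := by
      rw [hp, one_le_inv₀ (by positivity)]
      have : (n:NNReal)⁻¹ ≤ 2⁻¹ := by
        apply inv_anti₀ (by norm_num); exact_mod_cast h2
      rw [← NNReal.coe_le_coe] at this ⊢
      push_cast at *
      linarith
    have hpn : p < n := by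
      rw [hp, inv_lt_comm₀ (by positivity) hn0']
      exact lt_add_of_pos_left _ (by norm_num)
    have hp2 : p ≤ 2 := by
      rw [hp, inv_le_comm₀ (by positivity) (by norm_num)]
      have : (12:NNReal)⁻¹ ≤ (n:NNReal)⁻¹ := by
        apply inv_anti₀ hn0'; exact_mod_cast hn
      rw [← NNReal.coe_le_coe] at this ⊢
      push_cast at *
      linarith
    set C1 := eLpNormLESNormFDerivOfLeConst ℝ (volume : Measure (EuclideanSpace ℝ (Fin n))) Ω p (12/5)
    set M : ENNReal := (volume.restrict Ω) univ ^ (1 / (p:ENNReal).toReal - 1 / (2:ENNReal).toReal)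
    have hM : M ≠ ⊤ := by
      refine ENNReal.rpow_ne_top_of_nonneg ?_ (by simpa using hfin.ne)
      have : (p:ℝ) ≤ 2 := by exact_mod_cast hp2
      have : (0:ℝ) < p := by have : (1:ℝ) ≤ p := by exact_mod_cast hp1
                             linarith
      simp only [ENNReal.coe_toReal, ENNReal.toReal_ofNat, sub_nonneg]
      exact one_div_le_one_div_of_le (by assumption) (by assumption)
    refine ⟨C1 * M.toNNReal, fun φ hφ hc hs => ?_⟩
    have hφ1 : ContDiff ℝ 1 φ := hφ.of_le (by norm_cast)
    have hsupp : φ.support ⊆ Ω := (subset_tsupport φ).trans hs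
    have g1 := eLpNorm_le_eLpNorm_fderiv_of_le (volume : Measure (EuclideanSpace ℝ (Fin n)))
      hφ1 hsupp hp1 (by simpa using hpn) (q := 12/5) (by
        rw [finrank_euclideanSpace_fin, hpinv]; push_cast; norm_num) hb
    have hsd : ∀ x, x ∉ Ω → ‖fderiv ℝ φ x‖ = 0 := fun x hx => by
      rw [norm_eq_zero]
      by_contra hne
      exact hx (hs (support_fderiv_subset ℝ hne))
    have g2 : eLpNorm (fderiv ℝ φ) p volume = eLpNorm (fderiv ℝ φ) p (volume.restrict Ω) := by
      rw [eLp_restr _ _ hsd]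
    have g3 : eLpNorm (fderiv ℝ φ) p (volume.restrict Ω) ≤
        eLpNorm (fderiv ℝ φ) 2 (volume.restrict Ω) * M := by
      refine eLpNorm_le_eLpNorm_mul_rpow_measure_univ (by exact_mod_cast hp2) ?_
      exact (hφ.continuous_fderiv (by simp)).aestronglyMeasurable
    calc _ ≤ eLpNorm φ ((12/5 : NNReal) : ENNReal) volume := eLpNorm_restrict_le _ _ _ _
      _ ≤ C1 * (eLpNorm (fderiv ℝ φ) 2 (volume.restrict Ω) * M) := by
        refine g1.trans ?_
        rw [g2]; gcongr
      _ = _ := by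
        rw [ENNReal.coe_mul, ENNReal.coe_toNNReal hM]; ring
  · obtain rfl : n = 1 := le_antisymm h1 hn1
    set M : ENNReal := (volume.restrict Ω) univ ^ (1 / (1:ENNReal).toReal - 1 / (2:ENNReal).toReal)
    have hM : M ≠ ⊤ := by
      refine ENNReal.rpow_ne_top_of_nonneg ?_ (by simpa using hfin.ne)
      norm_num
    set N : ENNReal := (volume.restrict Ω) univ ^ ((((12/5 : NNReal) : ENNReal)).toReal)⁻¹
    have hN : N ≠ ⊤ := by
      refine ENNReal.rpow_ne_top_of_nonneg ?_ (by simpa using hfin.ne)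
      positivity
    refine ⟨N.toNNReal * M.toNNReal, fun φ hφ hc hs => ?_⟩
    have hsd : ∀ x, x ∉ Ω → ‖fderiv ℝ φ x‖ = 0 := fun x hx => by
      rw [norm_eq_zero]
      by_contra hne
      exact hx (hs (support_fderiv_subset ℝ hne))
    have hcont : Continuous (fun y => fderiv ℝ φ y) := hφ.continuous_fderiv (by simp)
    have hint : Integrable (fderiv ℝ φ) :=
      hcont.integrable_of_hasCompactSupport (hc.fderiv (𝕜 := ℝ))
    have g1 : eLpNorm φ ((12/5 : NNReal) : ENNReal) (volume.restrict Ω) ≤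
        N * ENNReal.ofReal (∫ y, ‖fderiv ℝ φ y‖) :=
      eLpNorm_le_of_ae_bound (Eventually.of_forall fun x => sob_dim_one hφ hc x)
    have g2 : ENNReal.ofReal (∫ y, ‖fderiv ℝ φ y‖) = eLpNorm (fderiv ℝ φ) 1 (volume.restrict Ω) := by
      rw [eLp_restr _ _ hsd, eLpNorm_one_eq_lintegral_enorm,
        ofReal_integral_norm_eq_lintegral_enorm hint]
    have g3 : eLpNorm (fderiv ℝ φ) 1 (volume.restrict Ω) ≤
        eLpNorm (fderiv ℝ φ) 2 (volume.restrict Ω) * M :=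
      eLpNorm_le_eLpNorm_mul_rpow_measure_univ (by norm_num) hcont.aestronglyMeasurable
    calc _ ≤ N * (eLpNorm (fderiv ℝ φ) 2 (volume.restrict Ω) * M) := by
          refine g1.trans ?_
          rw [g2]; gcongr
      _ = _ := by
        rw [ENNReal.coe_mul, ENNReal.coe_toNNReal hM, ENNReal.coe_toNNReal hN]; ring

/-- Sobolev in the form used. -/
lemma sob_real {n : ℕ} (hn1 : 1 ≤ n) (hn : n ≤ 12) {Ω : Set (EuclideanSpace ℝ (Fin n))}
    (hb : Bornology.IsBounded Ω) (hm : MeasurableSet Ω) :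
    ∃ C : ℝ, 0 < C ∧ ∀ φ : EuclideanSpace ℝ (Fin n) → ℝ, ContDiff ℝ (⊤ : ℕ∞) φ →
      HasCompactSupport φ → tsupport φ ⊆ Ω →
      ∫ x in Ω, |φ x| ^ (12/5 : ℝ) ≤ (C * ∫ x in Ω, ‖gradient φ x‖ ^ 2) ^ (6/5 : ℝ) := by
  obtain ⟨C, hC⟩ := sob_eLp hn1 hn hb hm
  refine ⟨(C:ℝ) ^ 2 + 1, by positivity, fun φ hφ hc hs => ?_⟩
  have h := hC φ hφ hc hs
  have hcont : Continuous (fun y => fderiv ℝ φ y) := hφ.continuous_fderiv (by simp)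
  have m1 : MemLp φ ((12/5 : NNReal) : ENNReal) (volume.restrict Ω) :=
    (hφ.continuous.memLp_of_hasCompactSupport hc).restrict Ω
  have m2 : MemLp (fderiv ℝ φ) 2 (volume.restrict Ω) :=
    (hcont.memLp_of_hasCompactSupport (hc.fderiv (𝕜 := ℝ))).restrict Ω
  have e1 := m1.eLpNorm_eq_integral_rpow_norm (by simp) ENNReal.coe_ne_top
  have e2 := m2.eLpNorm_eq_integral_rpow_norm (by simp) (by simp)
  rw [e1, e2, ← ENNReal.ofReal_coe_nnreal (p := C), ← ENNReal.ofReal_mul (by positivity),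
    ENNReal.ofReal_le_ofReal_iff (by positivity)] at h
  simp only [ENNReal.coe_toReal, ENNReal.toReal_ofNat] at h
  push_cast at h
  simp only [Real.norm_eq_abs] at h
  set I := ∫ x in Ω, |φ x| ^ (12/5 : ℝ)
  have hJ : ∫ x in Ω, ‖fderiv ℝ φ x‖ ^ (2:ℝ) = ∫ x in Ω, ‖gradient φ x‖ ^ 2 := by
    simp only [norm_gradient_eq]; norm_cast
  rw [hJ] at h
  set J := ∫ x in Ω, ‖gradient φ x‖ ^ 2
  have hI0 : 0 ≤ I := integral_nonneg fun x => by positivity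
  have hJ0 : 0 ≤ J := integral_nonneg fun x => by positivity
  have h' := Real.rpow_le_rpow (by positivity) h (show (0:ℝ) ≤ 12/5 by norm_num)
  rw [← Real.rpow_mul hI0] at h'
  norm_num at h'
  refine h'.trans ?_
  have : (C:ℝ) * J ^ (1/2 : ℝ) = ((C:ℝ)^2 * J) ^ (1/2 : ℝ) := by
    rw [Real.mul_rpow (by positivity) hJ0, ← Real.sqrt_eq_rpow, ← Real.sqrt_eq_rpow,
      Real.sqrt_sq (by positivity)]
  rw [this, ← Real.rpow_mul (by positivity)]
  norm_num
  gcongr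
  linarith

/-- Poincare. -/
lemma poinc_real {n : ℕ} (hn1 : 1 ≤ n) (hn : n ≤ 12) {Ω : Set (EuclideanSpace ℝ (Fin n))}
    (hb : Bornology.IsBounded Ω) (hm : MeasurableSet Ω) :
    ∃ C : ℝ, 0 < C ∧ ∀ φ : EuclideanSpace ℝ (Fin n) → ℝ, ContDiff ℝ (⊤ : ℕ∞) φ →
      HasCompactSupport φ → tsupport φ ⊆ Ω →
      ∫ x in Ω, (φ x) ^ 2 ≤ C * ∫ x in Ω, ‖gradient φ x‖ ^ 2 := by
  obtain ⟨C, hC⟩ := sob_eLp hn1 hn hb hm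
  have hfin : volume Ω < ⊤ := hb.measure_lt_top
  have : IsFiniteMeasure (volume.restrict Ω) := ⟨by simpa using hfin⟩
  set M : ENNReal := (volume.restrict Ω) univ ^ 
    (1 / (2:ENNReal).toReal - 1 / (((12/5 : NNReal) : ENNReal)).toReal)
  have hM : M ≠ ⊤ := by
    refine ENNReal.rpow_ne_top_of_nonneg ?_ (by simpa using hfin.ne)
    simp only [ENNReal.coe_toReal, ENNReal.toReal_ofNat]; push_cast; norm_num
  refine ⟨((C * M.toNNReal : NNReal):ℝ) ^ 2 + 1, by positivity, fun φ hφ hc hs => ?_⟩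
  have h := hC φ hφ hc hs
  have hcont : Continuous (fun y => fderiv ℝ φ y) := hφ.continuous_fderiv (by simp)
  have m1 : MemLp φ 2 (volume.restrict Ω) :=
    (hφ.continuous.memLp_of_hasCompactSupport hc).restrict Ω
  have m2 : MemLp (fderiv ℝ φ) 2 (volume.restrict Ω) :=
    (hcont.memLp_of_hasCompactSupport (hc.fderiv (𝕜 := ℝ))).restrict Ω
  have g3 : eLpNorm φ 2 (volume.restrict Ω) ≤
        eLpNorm φ ((12/5 : NNReal) : ENNReal) (volume.restrict Ω) * M := by
    refine eLpNorm_le_eLpNorm_mul_rpow_measure_univ ?_ hφ.continuous.aestronglyMeasurable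
    have : (2:NNReal) ≤ 12/5 := by
      rw [← NNReal.coe_le_coe]; push_cast; norm_num
    exact_mod_cast this
  have h3 : eLpNorm φ 2 (volume.restrict Ω) ≤ ((C * M.toNNReal : NNReal) : ENNReal) *
      eLpNorm (fderiv ℝ φ) 2 (volume.restrict Ω) := by
    refine g3.trans ?_
    rw [ENNReal.coe_mul, ENNReal.coe_toNNReal hM]
    calc _ ≤ (C * eLpNorm (fderiv ℝ φ) 2 (volume.restrict Ω)) * M := by gcongr
      _ = _ := by ring
  have e1 := m1.eLpNorm_eq_integral_rpow_norm (by simp) (by simp)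
  have e2 := m2.eLpNorm_eq_integral_rpow_norm (by simp) (by simp)
  set C' := C * M.toNNReal
  rw [e1, e2, ← ENNReal.ofReal_coe_nnreal (p := C'), ← ENNReal.ofReal_mul (by positivity),
    ENNReal.ofReal_le_ofReal_iff (by positivity)] at h3
  simp only [ENNReal.toReal_ofNat] at h3
  have hJ : ∫ x in Ω, ‖fderiv ℝ φ x‖ ^ (2:ℝ) = ∫ x in Ω, ‖gradient φ x‖ ^ 2 := by
    simp only [norm_gradient_eq]; norm_cast
  have hI : ∫ x in Ω, ‖φ x‖ ^ (2:ℝ) = ∫ x in Ω, (φ x) ^ 2 := by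
    refine integral_congr_ae (Eventually.of_forall fun x => ?_)
    simp only [Real.norm_eq_abs]; norm_cast; exact sq_abs _
  rw [hJ, hI] at h3
  set I := ∫ x in Ω, (φ x) ^ 2
  set J := ∫ x in Ω, ‖gradient φ x‖ ^ 2
  have hI0 : 0 ≤ I := integral_nonneg fun x => by positivity
  have hJ0 : 0 ≤ J := integral_nonneg fun x => by positivity
  rw [show (2:ℝ)⁻¹ = 1/2 by norm_num, ← Real.sqrt_eq_rpow, ← Real.sqrt_eq_rpow] at h3
  have h4 := pow_le_pow_left₀ (Real.sqrt_nonneg _) h3 2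
  rw [mul_pow, Real.sq_sqrt hI0, Real.sq_sqrt hJ0] at h4
  nlinarith

/-! ### basic facts on `f` -/

/-- The open interval `(0, a_f)`. -/
def D0 (a : EReal) : Set ℝ := {t : ℝ | 0 < t ∧ (t : EReal) < a}

lemma isOpen_ltE (a : EReal) : IsOpen {t : ℝ | (t : EReal) < a} :=
  isOpen_lt continuous_coe_real_ereal continuous_const

lemma isOpen_D0 (a : EReal) : IsOpen (D0 a) := (isOpen_Ioi (a := (0:ℝ))).inter (isOpen_ltE a)

lemma D0_sub (a : EReal) : D0 a ⊆ domf a := fun _ h => ⟨h.1.le, h.2⟩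

lemma D0_mem_of_le {a : EReal} {s t : ℝ} (hs : 0 < s) (hst : s ≤ t) (ht : (t : EReal) < a) :
    s ∈ D0 a := ⟨hs, lt_of_le_of_lt (EReal.coe_le_coe_iff.2 hst) ht⟩

lemma convex_D0 (a : EReal) : Convex ℝ (D0 a) := by
  refine OrdConnected.convex ⟨fun x hx y hy z hz => D0_mem_of_le (hx.1.trans_le hz.1) hz.2 hy.2⟩

lemma f_cd {a : EReal} {f : ℝ → ℝ} (hf : HypH a f) : ContDiffOn ℝ (⊤ : ℕ∞) f (D0 a) :=
  hf.smooth.mono (D0_sub a)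

lemma f_cdAt {a : EReal} {f : ℝ → ℝ} (hf : HypH a f) {t : ℝ} (ht : t ∈ D0 a) :
    ContDiffAt ℝ (⊤ : ℕ∞) f t := (f_cd hf).contDiffAt ((isOpen_D0 a).mem_nhds ht)

lemma f_diff {a : EReal} {f : ℝ → ℝ} (hf : HypH a f) {t : ℝ} (ht : t ∈ D0 a) :
    DifferentiableAt ℝ f t := (f_cdAt hf ht).differentiableAt (by simp)

lemma f'_cd {a : EReal} {f : ℝ → ℝ} (hf : HypH a f) : ContDiffOn ℝ (⊤ : ℕ∞) (deriv f) (D0 a) :=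
  (f_cd hf).deriv_of_isOpen (isOpen_D0 a) (by norm_cast)

lemma f'_diff {a : EReal} {f : ℝ → ℝ} (hf : HypH a f) {t : ℝ} (ht : t ∈ D0 a) :
    DifferentiableAt ℝ (deriv f) t :=
  ((f'_cd hf).contDiffAt ((isOpen_D0 a).mem_nhds ht)).differentiableAt (by simp)

lemma f'_mono {a : EReal} {f : ℝ → ℝ} (hf : HypH a f) : MonotoneOn (deriv f) (D0 a) :=
  (hf.convex.subset (D0_sub a) (convex_D0 a)).monotoneOn_deriv (fun _ ht => f_diff hf ht)

lemma f'_pos {a : EReal} {f : ℝ → ℝ} (hf : HypH a f) {t : ℝ} (ht : t ∈ D0 a) : 0 < deriv f t := by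
  have h2 : t/2 ∈ D0 a := D0_mem_of_le (half_pos ht.1) (by linarith [ht.1]) ht.2
  have h := (hf.convex.subset (D0_sub a) (convex_D0 a)).slope_le_deriv h2 ht
    (by linarith [ht.1]) (f_diff hf ht)
  refine lt_of_lt_of_le ?_ h
  rw [slope_def_field]
  have := hf.mono (D0_sub a h2) (D0_sub a ht) (by linarith [ht.1])
  apply div_pos <;> linarith [ht.1]

lemma f''_nonneg {a : EReal} {f : ℝ → ℝ} (hf : HypH a f) {t : ℝ} (ht : t ∈ D0 a) :
    0 ≤ deriv (deriv f) t := by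
  have := (f'_mono hf).derivWithin_nonneg (x := t)
  rwa [derivWithin_of_mem_nhds ((isOpen_D0 a).mem_nhds ht)] at this

lemma D0_nonempty {a : EReal} (ha : 0 < a) (b : ℝ) (hb : 0 < b) : ∃ t ∈ D0 a, t ≤ b := by
  obtain ⟨q, hq1, hq2⟩ := EReal.lt_iff_exists_real_btwn.1 ha
  have hq1' : 0 < q := by exact_mod_cast hq1
  exact ⟨min q b, D0_mem_of_le (lt_min hq1' hb) (min_le_left _ _) hq2, min_le_right _ _⟩

/-! ### maximum principle -/

lemma lap_nonneg_of_isLocalMin {n : ℕ} {W : EuclideanSpace ℝ (Fin n) → ℝ}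
    (hW : ContDiff ℝ (⊤ : ℕ∞) W) {x : EuclideanSpace ℝ (Fin n)} (hx : IsLocalMin W x) :
    0 ≤ lap W x := by
  rw [lap_eq W hW]
  refine Finset.sum_nonneg fun i _ => ?_
  set e : EuclideanSpace ℝ (Fin n) := EuclideanSpace.single i (1:ℝ)
  have hl : ∀ t : ℝ, HasDerivAt (fun t : ℝ => x + t • e) e t := fun t => by
    simpa using ((hasDerivAt_id t).smul_const e).const_add x
  set g : ℝ → ℝ := fun t => W (x + t • e) with hg
  have hg1 : ∀ t, HasDerivAt g (fderiv ℝ W (x + t • e) e) t := fun t =>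
    ((hW.differentiable (by simp) (x + t • e)).hasFDerivAt).comp_hasDerivAt t (hl t)
  have hg1' : deriv g = fun t => fderiv ℝ W (x + t • e) e := funext fun t => (hg1 t).deriv
  have hWe : ContDiff ℝ (⊤ : ℕ∞) (fun x => fderiv ℝ W x e) :=
    (hW.fderiv_right (m := (⊤ : ℕ∞)) (by norm_cast)).clm_apply contDiff_const
  have hg2 : deriv (deriv g) 0 = fderiv ℝ (fun y => fderiv ℝ W y e) x e := by
    rw [hg1']
    have := ((hWe.differentiable (by simp) (x + (0:ℝ) • e)).hasFDerivAt).comp_hasDerivAt 0 (hl 0)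
    have h2 := this.deriv
    simp only [zero_smul, add_zero] at h2
    exact h2
  have hmin : IsLocalMin g 0 := by
    have hc : ContinuousAt (fun t : ℝ => x + t • e) 0 := (hl 0).continuousAt
    have : IsLocalMin W ((fun t : ℝ => x + t • e) 0) := by simpa using hx
    exact hc.tendsto.eventually (p := fun y => W ((fun t : ℝ => x + t • e) 0) ≤ W y) this
  by_contra hneg
  rw [not_le, ← hg2] at hneg
  have hmax := isLocalMax_of_deriv_deriv_neg hneg hmin.deriv_eq_zero (hg1 0).continuousAt
  have hconst : g =ᶠ[𝓝 0] fun _ => g 0 := by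
    filter_upwards [hmin, hmax] with t h1 h2
    exact le_antisymm h2 h1
  have : deriv (deriv g) 0 = 0 := by
    have h1 : deriv g =ᶠ[𝓝 0] deriv (fun _ => g 0) := hconst.deriv
    rw [h1.deriv_eq]; simp
  linarith

lemma max_principle {n : ℕ} {O : Set (EuclideanSpace ℝ (Fin n))} (hO : IsOpen O)
    (hb : Bornology.IsBounded O) {W : EuclideanSpace ℝ (Fin n) → ℝ}
    (hW : ContDiff ℝ (⊤ : ℕ∞) W) (hl : ∀ x ∈ O, lap W x < 0) (hf : ∀ x ∈ frontier O, 0 ≤ W x) :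
    ∀ x ∈ O, 0 ≤ W x := by
  intro x hx
  obtain ⟨y, hy, hmin⟩ := hb.isCompact_closure.exists_isMinOn ⟨x, subset_closure hx⟩
    hW.continuous.continuousOn
  refine le_trans ?_ (hmin (subset_closure hx))
  by_cases hyO : y ∈ O
  · exfalso
    have : IsLocalMin W y := by
      filter_upwards [hO.mem_nhds hyO] with z hz
      exact hmin (subset_closure hz)
    linarith [hl y hyO, lap_nonneg_of_isLocalMin hW this]
  · exact hf y (by rw [frontier, hO.interior_eq]; exact ⟨hy, hyO⟩)

lemma lap_add_mul {n : ℕ} {v q : EuclideanSpace ℝ (Fin n) → ℝ} (hv : ContDiff ℝ (⊤ : ℕ∞) v)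
    (hq : ContDiff ℝ (⊤ : ℕ∞) q) (c : ℝ) (x : EuclideanSpace ℝ (Fin n)) :
    lap (fun x => v x + c * q x) x = lap v x + c * lap q x := by
  rw [lap_eq _ hv, lap_eq _ hq, lap_eq _ (hv.add (contDiff_const.mul hq)), Finset.mul_sum,
    ← Finset.sum_add_distrib]
  refine Finset.sum_congr rfl fun i _ => ?_
  set e : EuclideanSpace ℝ (Fin n) := EuclideanSpace.single i (1:ℝ)
  have hve : ContDiff ℝ (⊤ : ℕ∞) (fun x => fderiv ℝ v x e) :=
    (hv.fderiv_right (m := (⊤ : ℕ∞)) (by norm_cast)).clm_apply contDiff_const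
  have hqe : ContDiff ℝ (⊤ : ℕ∞) (fun x => fderiv ℝ q x e) :=
    (hq.fderiv_right (m := (⊤ : ℕ∞)) (by norm_cast)).clm_apply contDiff_const
  have h1 : ∀ {A B : EuclideanSpace ℝ (Fin n) → ℝ}, ContDiff ℝ (⊤ : ℕ∞) A → ContDiff ℝ (⊤ : ℕ∞) B →
      ∀ y, fderiv ℝ (fun x => A x + c * B x) y e = fderiv ℝ A y e + c * fderiv ℝ B y e := by
    intro A B hA hB y
    have := ((hA.differentiable (by simp) y).hasFDerivAt.add
      ((hB.differentiable (by simp) y).hasFDerivAt.const_mul c))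
    have h2 := this.fderiv
    have h3 : fderiv ℝ (fun x => A x + c * B x) y = fderiv ℝ A y + c • fderiv ℝ B y := h2
    rw [h3]; simp
  rw [funext (h1 hv hq), h1 hve hqe]

lemma lap_neg {n : ℕ} {v : EuclideanSpace ℝ (Fin n) → ℝ} (hv : ContDiff ℝ (⊤ : ℕ∞) v) (c : ℝ)
    (x : EuclideanSpace ℝ (Fin n)) :
    lap (fun x => c * v x) x = c * lap v x := by
  have h := lap_add_mul (v := fun _ => 0) contDiff_const hv c x
  have h0 : lap (fun _ : EuclideanSpace ℝ (Fin n) => (0:ℝ)) x = 0 := by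
    rw [lap_eq _ contDiff_const]; simp
  rw [h0] at h
  simpa using h

lemma contDiff_quad {n : ℕ} (x0 : EuclideanSpace ℝ (Fin n)) (s : ℝ) :
    ContDiff ℝ (⊤ : ℕ∞) (fun x : EuclideanSpace ℝ (Fin n) => ‖x - x0‖ ^ 2 - s) :=
  ((contDiff_id.sub contDiff_const).norm_sq ℝ).sub contDiff_const

lemma lap_quad {n : ℕ} (x0 x : EuclideanSpace ℝ (Fin n)) (s : ℝ) :
    lap (fun x : EuclideanSpace ℝ (Fin n) => ‖x - x0‖ ^ 2 - s) x = 2 * n := by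
  rw [lap_eq _ (contDiff_quad x0 s)]
  have h1 : ∀ (y e : EuclideanSpace ℝ (Fin n)),
      fderiv ℝ (fun x : EuclideanSpace ℝ (Fin n) => ‖x - x0‖ ^ 2 - s) y e = 2 * inner ℝ (y - x0) e := by
    intro y e
    have h := (((hasFDerivAt_id y).sub_const x0).norm_sq).sub_const s
    have h3 : fderiv ℝ (fun x : EuclideanSpace ℝ (Fin n) => ‖x - x0‖ ^ 2 - s) y = _ := h.fderiv
    rw [h3]; simp [inner_sub_left]
  have h2 : ∀ e : EuclideanSpace ℝ (Fin n),
      fderiv ℝ (fun y : EuclideanSpace ℝ (Fin n) => 2 * inner ℝ (y - x0) e) x e = 2 * inner ℝ e e := by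
    intro e
    have h := ((((hasFDerivAt_id x).sub_const x0).inner ℝ (hasFDerivAt_const e x))).const_mul (2:ℝ)
    have h3 : fderiv ℝ (fun y : EuclideanSpace ℝ (Fin n) => 2 * inner ℝ (y - x0) e) x = _ := h.fderiv
    rw [h3]; simp
  simp only [h1, h2]
  simp [mul_comm]

/-! ### consequences for solutions -/

lemma sol_le {n : ℕ} {Ω : Set (EuclideanSpace ℝ (Fin n))} (hΩ : GoodDomain Ω) {a : EReal}
    (ha : 0 < a) {lam : ℝ} {f : ℝ → ℝ} {u : EuclideanSpace ℝ (Fin n) → ℝ}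
    (hs : Solves Ω a lam f u) : ∃ T ∈ D0 a, ∀ x ∈ Ω, u x ≤ T := by
  obtain ⟨hO, hb, ⟨x, hx⟩⟩ := hΩ
  obtain ⟨hu, hr, -, hf, -⟩ := hs
  obtain ⟨y, hy, hmax⟩ := hb.isCompact_closure.exists_isMaxOn ⟨x, subset_closure hx⟩
    hu.continuous.continuousOn
  obtain ⟨t, ht, -⟩ := D0_nonempty ha 1 one_pos
  have hya : (u y : EReal) < a := by
    by_cases hyO : y ∈ Ω
    · exact (hr y hyO).2
    · rw [hf y (by rw [frontier, hO.interior_eq]; exact ⟨hy, hyO⟩)]; exact_mod_cast ha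
  refine ⟨max t (u y), ⟨lt_max_of_lt_left ht.1, ?_⟩, fun z hz =>
    (hmax (subset_closure hz)).trans (le_max_right _ _)⟩
  rcases max_choice t (u y) with h | h <;> rw [h]
  exacts [ht.2, hya]

lemma sqrt_f'_bdd {n : ℕ} {Ω : Set (EuclideanSpace ℝ (Fin n))} (hΩ : GoodDomain Ω) {a : EReal}
    {lam : ℝ} {f : ℝ → ℝ} (hf : HypH a f) {u : EuclideanSpace ℝ (Fin n) → ℝ}
    (hs : Solves Ω a lam f u) : ∃ B, ∀ x ∈ Ω, Real.sqrt (deriv f (u x)) ≤ B := by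
  obtain ⟨T, hT, hle⟩ := sol_le hΩ hf.a_pos hs
  refine ⟨max (Real.sqrt (deriv f 0)) (Real.sqrt (deriv f T)), fun x hx => ?_⟩
  rcases (hs.2.1 x hx).1.eq_or_lt with h | h
  · rw [← h]; exact le_max_left _ _
  · refine le_trans (Real.sqrt_le_sqrt ?_) (le_max_right _ _)
    exact f'_mono hf ⟨h, (hs.2.1 x hx).2⟩ hT (hle x hx)

lemma bdd_integrableOn {n : ℕ} {Ω : Set (EuclideanSpace ℝ (Fin n))} (hΩ : GoodDomain Ω)
    {g : EuclideanSpace ℝ (Fin n) → ℝ} (hg : AEStronglyMeasurable g (volume.restrict Ω))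
    {B : ℝ} (hB : ∀ x ∈ Ω, |g x| ≤ B) : IntegrableOn g Ω := by
  refine IntegrableOn.of_bound hΩ.2.1.measure_lt_top hg B ?_
  exact (ae_restrict_iff' hΩ.1.measurableSet).2 (Eventually.of_forall hB)

lemma meas_sqrt_f' {n : ℕ} (f : ℝ → ℝ) {u : EuclideanSpace ℝ (Fin n) → ℝ}
    (hu : Continuous u) : Measurable (fun x => Real.sqrt (deriv f (u x))) :=
  ((measurable_deriv f).comp hu.measurable).sqrt

lemma v_nonneg {n : ℕ} {Ω : Set (EuclideanSpace ℝ (Fin n))} (hΩ : GoodDomain Ω) {a : EReal}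
    {lam : ℝ} (hlam : 0 < lam) {f : ℝ → ℝ} (hf : HypH a f) {u : EuclideanSpace ℝ (Fin n) → ℝ}
    (hs : Solves Ω a lam f u) : ∀ x ∈ Ω, 0 ≤ - lap u x := by
  have hc := contDiff_lap u hs.1
  have h := max_principle (W := fun x => (-1) * lap u x) hΩ.1 hΩ.2.1 (contDiff_const.mul hc) ?_ ?_
  · intro x hx; simpa using h x hx
  · intro x hx
    rw [lap_neg hc, hs.2.2.1 x hx]
    have := hf.pos _ (hs.2.1 x hx)
    nlinarith [mul_pos hlam this]
  · intro x hx
    simp [hs.2.2.2.2 x hx]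

lemma mu_bound {n : ℕ} (hn : 1 ≤ n) {Ω : Set (EuclideanSpace ℝ (Fin n))} (hΩ : GoodDomain Ω)
    {a : EReal} {f : ℝ → ℝ} (hf : HypH a f) :
    ∃ M : ℝ, 0 < M ∧ ∀ (lam : ℝ) (u : EuclideanSpace ℝ (Fin n) → ℝ), 0 < lam →
      Solves Ω a lam f u → StabIneq Ω lam f u → Real.sqrt lam ≤ M := by
  have hn0 : (0:ℝ) < n := by exact_mod_cast hn
  have hΩ' := hΩ
  obtain ⟨hO, hb, ⟨x0, hx0⟩⟩ := hΩ
  obtain ⟨r, hr, hball⟩ := Metric.isOpen_iff.1 hO x0 hx0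
  obtain ⟨c1, hc1, hc1'⟩ : ∃ c1 : ℝ, 0 < c1 ∧ 2 * n * c1 < f 0 :=
    ⟨f 0 / (4 * n), by have := hf.f0_pos; positivity, by
      have := hf.f0_pos; field_simp; linarith⟩
  obtain ⟨c2, hc2, hc2'⟩ : ∃ c2 : ℝ, 0 < c2 ∧ 2 * n * c2 < c1 * (3/4 * r ^ 2) :=
    ⟨c1 * r ^ 2 / (4 * n), by positivity, by field_simp; nlinarith [sq_pos_of_pos hr]⟩
  obtain ⟨ts, hts, htsle⟩ := D0_nonempty hf.a_pos (c2 * (3/16 * r ^ 2)) (by positivity)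
  let φ : ContDiffBump x0 := ⟨r/8, r/4, by positivity, by linarith⟩
  have hφs : tsupport φ ⊆ Ω := by
    rw [φ.tsupport_eq]
    exact (Metric.closedBall_subset_ball (by show r/4 < r; linarith)).trans hball
  have hsq := Real.sqrt_pos.2 (f'_pos hf hts)
  have hφc : Continuous φ := φ.continuous
  have hφint : Integrable (fun x => (φ x) ^ 2) :=
    (hφc.pow 2).integrable_of_hasCompactSupport (by
      have := φ.hasCompactSupport.mul_left (f := fun x => φ x)
      simpa [pow_two, Pi.mul_def] using this)
  have hI : 0 < ∫ x in Ω, (φ x) ^ 2 := by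
    rw [setIntegral_eq_integral_of_forall_compl_eq_zero]
    · refine integral_pos_of_integrable_nonneg_nonzero (x := x0) (hφc.pow 2) hφint
        (fun x => sq_nonneg _) ?_
      have : φ x0 = 1 := φ.one_of_mem_closedBall (by simp; show 0 ≤ r/8; positivity)
      simp [this]
    · intro x hx
      have : φ x = 0 := by
        by_contra h
        exact hx (hφs (subset_tsupport _ h))
      simp [this]
  set I := ∫ x in Ω, (φ x) ^ 2
  set G := ∫ x in Ω, ‖gradient (φ : EuclideanSpace ℝ (Fin n) → ℝ) x‖ ^ 2
  refine ⟨max 1 (G / (Real.sqrt (deriv f ts) * I)), lt_max_of_lt_left one_pos, ?_⟩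
  intro lam u hlam hs hst
  rcases le_or_gt lam 1 with h1 | h1
  · exact le_max_of_le_left (by simpa using Real.sqrt_le_sqrt h1)
  refine le_max_of_le_right ?_
  rw [le_div_iff₀ (by positivity)]
  have hlapc := contDiff_lap u hs.1
  have hfu : ∀ x ∈ Ω, f 0 ≤ f (u x) := fun x hx =>
    hf.mono.monotoneOn ⟨le_rfl, by exact_mod_cast hf.a_pos⟩ (hs.2.1 x hx) (hs.2.1 x hx).1
  have hv : ∀ x ∈ Ω, lam * c1 * (r ^ 2 - ‖x - x0‖ ^ 2) ≤ - lap u x := by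
    have h := max_principle (W := fun x => (-1) * lap u x + (lam * c1) * (‖x - x0‖ ^ 2 - r ^ 2))
      hO hb ((contDiff_const.mul hlapc).add (contDiff_const.mul (contDiff_quad x0 _))) ?_ ?_
    · intro x hx; have := h x hx; linarith
    · intro x hx
      rw [lap_add_mul (contDiff_const.mul hlapc) (contDiff_quad x0 _), lap_neg hlapc, lap_quad,
        hs.2.2.1 x hx]
      nlinarith [hfu x hx, mul_lt_mul_of_pos_left hc1' hlam,
        mul_le_mul_of_nonneg_left (hfu x hx) hlam.le]
    · intro x hx
      rw [hs.2.2.2.2 x hx]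
      have : x ∉ Metric.ball x0 r := fun h => by
        have h2 := hball h
        rw [frontier, hO.interior_eq] at hx
        exact hx.2 h2
      rw [Metric.mem_ball, dist_eq_norm, not_lt] at this
      have h2 : r ^ 2 ≤ ‖x - x0‖ ^ 2 := by gcongr
      have := mul_nonneg (mul_pos hlam hc1).le (sub_nonneg.2 h2)
      linarith
  have hu2 : ∀ x ∈ Metric.ball x0 (r/2), lam * c2 * ((r/2) ^ 2 - ‖x - x0‖ ^ 2) ≤ u x := by
    have hsub : Metric.closedBall x0 (r/2) ⊆ Ω :=
      (Metric.closedBall_subset_ball (by linarith)).trans hball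
    have h := max_principle (O := Metric.ball x0 (r/2)) (W := fun x => u x + (lam * c2) * (‖x - x0‖ ^ 2 - (r/2) ^ 2))
      Metric.isOpen_ball Metric.isBounded_ball
      (hs.1.add (contDiff_const.mul (contDiff_quad x0 _))) ?_ ?_
    · intro x hx; have := h x hx; linarith
    · intro x hx
      rw [lap_add_mul hs.1 (contDiff_quad x0 _), lap_quad]
      have h3 := hv x (hsub (Metric.ball_subset_closedBall hx))
      rw [Metric.mem_ball, dist_eq_norm] at hx
      have h4 : ‖x - x0‖ ^ 2 ≤ (r/2) ^ 2 := by gcongr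
      have h5 : lam * c1 * (3/4 * r ^ 2) ≤ lam * c1 * (r ^ 2 - ‖x - x0‖ ^ 2) := by
        apply mul_le_mul_of_nonneg_left _ (by positivity); nlinarith
      nlinarith [mul_lt_mul_of_pos_left hc2' hlam]
    · intro x hx
      have hx' := Metric.frontier_ball_subset_sphere hx
      have h3 : ‖x - x0‖ = r/2 := by rw [← dist_eq_norm]; exact hx'
      have h4 := (hs.2.1 x (hsub (Metric.sphere_subset_closedBall hx'))).1
      rw [h3]; linarith
  obtain ⟨B, hB⟩ := sqrt_f'_bdd hΩ' hf hs
  have key : Real.sqrt (deriv f ts) * I ≤ ∫ x in Ω, Real.sqrt (deriv f (u x)) * (φ x) ^ 2 := by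
    rw [← integral_const_mul]
    refine setIntegral_mono_on (hφint.integrableOn.const_mul _) ?_ hO.measurableSet ?_
    · refine bdd_integrableOn (B := B * 1) hΩ' ?_ ?_
      · exact ((meas_sqrt_f' f hs.1.continuous).mul (hφc.measurable.pow_const 2)).aestronglyMeasurable
      · intro x hx
        rw [abs_of_nonneg (by positivity)]
        have : (φ x) ^ 2 ≤ 1 := by
          have := φ.le_one (x := x); have := φ.nonneg (x := x); nlinarith
        have h0 := (Real.sqrt_nonneg _).trans (hB x hx)
        exact mul_le_mul (hB x hx) this (sq_nonneg _) h0
    · intro x hx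
      by_cases hφx : φ x = 0
      · simp [hφx]
      have hxb : x ∈ Metric.ball x0 (r/4) := by
        have : x ∈ Function.support φ := hφx
        rw [φ.support_eq] at this; exact this
      have h3 := hu2 x (Metric.ball_subset_ball (by linarith) hxb)
      rw [Metric.mem_ball, dist_eq_norm] at hxb
      have h4 : ‖x - x0‖ ^ 2 ≤ (r/4) ^ 2 := by gcongr
      have h5 : c2 * (3/16 * r ^ 2) ≤ lam * c2 * ((r/2) ^ 2 - ‖x - x0‖ ^ 2) := by
        have : c2 * (3/16 * r ^ 2) ≤ lam * (c2 * (3/16 * r ^ 2)) :=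
          le_mul_of_one_le_left (by positivity) h1.le
        refine this.trans ?_
        rw [mul_assoc]
        gcongr
        nlinarith
      have h6 : ts ≤ u x := by linarith
      gcongr
      exact f'_mono hf hts ⟨hts.1.trans_le h6, (hs.2.1 x hx).2⟩ h6
  have := hst φ φ.contDiff φ.hasCompactSupport hφs
  calc _ ≤ Real.sqrt lam * ∫ x in Ω, Real.sqrt (deriv f (u x)) * (φ x) ^ 2 := by gcongr
    _ ≤ _ := this

/-! ### choice of parameters -/

lemma exists_beta {τ : ℝ} (h0 : 0 < τ) (h1 : τ ≤ 1) : ∃ β : ℝ, 1 < β ∧ 5 * τ < 2 * (2 - τ) * β ∧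
    (2 - τ) ^ 2 * β ^ 4 - 8 * (2 - τ) * β ^ 2 + 4 * (4 - 3 * τ) * β - 4 * (1 - τ) < 0 := by
  have hx : 0 < 2 - τ := by linarith
  obtain ⟨b, hb1, hb2, hb3⟩ : ∃ b : ℝ, 1 ≤ b ∧ 5 * τ ≤ 2 * (2 - τ) * b ∧
    (2 - τ) ^ 2 * b ^ 4 - 8 * (2 - τ) * b ^ 2 + 4 * (4 - 3 * τ) * b - 4 * (1 - τ) < 0 := by
    rcases le_or_gt τ (4/7) with h | h
    · exact ⟨1, le_rfl, by linarith, by nlinarith⟩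
    · refine ⟨5 * τ / (2 * (2 - τ)), ?_, ?_, ?_⟩
      · rw [le_div_iff₀ (by positivity)]; linarith
      · apply le_of_eq; field_simp
      · have key : 625*τ^4+1344*τ^3-3520*τ^2+1792*τ-256 < 0 := by
          have e1 : 0 ≤ (τ - 4/7) * (1 - τ) := mul_nonneg (by linarith) (by linarith)
          have e2 : 0 ≤ (τ - 4/7) * (1 - τ) * (τ - 4/7) := mul_nonneg e1 (by linarith)
          have e3 : 0 ≤ (τ - 4/7) * (1 - τ) * (τ - 4/7) ^ 2 := mul_nonneg e1 (sq_nonneg _)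
          nlinarith
        have : (2 - τ) ^ 2 * (5 * τ / (2 * (2 - τ))) ^ 4 - 8 * (2 - τ) * (5 * τ / (2 * (2 - τ))) ^ 2
            + 4 * (4 - 3 * τ) * (5 * τ / (2 * (2 - τ))) - 4 * (1 - τ)
            = (625*τ^4+1344*τ^3-3520*τ^2+1792*τ-256) / (16 * (2 - τ) ^ 2) := by
          field_simp; ring
        rw [this]
        exact div_neg_of_neg_of_pos key (by positivity)
  have hc : ContinuousAt (fun b : ℝ => (2 - τ) ^ 2 * b ^ 4 - 8 * (2 - τ) * b ^ 2 +
      4 * (4 - 3 * τ) * b - 4 * (1 - τ)) b := by fun_prop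
  have he := (hc.eventually_lt_const hb3).filter_mono (nhdsWithin_le_nhds (s := Ioi b))
  obtain ⟨β, hβ, hβb⟩ := (he.and self_mem_nhdsWithin).exists
  have hβb : b < β := hβb
  exact ⟨β, by linarith, by nlinarith, hβ⟩

/-- Extract a threshold from an eventual property at `a_f`. -/
lemma afFilter_ev {a : EReal} (ha : 0 < a) {P : ℝ → Prop} (h : ∀ᶠ t in afFilter a, P t) :
    ∃ t1 ∈ D0 a, ∀ t ∈ D0 a, t1 ≤ t → P t := by
  unfold afFilter at h
  split_ifs at h with hT
  · subst hT
    obtain ⟨N, hN⟩ := eventually_atTop.1 h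
    exact ⟨max N 1, ⟨by positivity, EReal.coe_lt_top _⟩,
      fun t _ ht => hN t ((le_max_left _ _).trans ht)⟩
  · have hb : a ≠ ⊥ := by rintro rfl; simp at ha
    set r := a.toReal with hr
    have har : a = (r : EReal) := (EReal.coe_toReal hT hb).symm
    have hr0 : 0 < r := by rw [har] at ha; exact_mod_cast ha
    obtain ⟨l, hl, hl2⟩ := (mem_nhdsLT_iff_exists_Ioo_subset' hr0).1 h
    have hl : l < r := hl
    refine ⟨max (r/2) ((l + r)/2), ⟨lt_max_of_lt_left (by linarith), ?_⟩, fun t ht htt => ?_⟩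
    · rw [har]; norm_cast
      exact max_lt (by linarith) (by linarith)
    · have h2 : t < r := by have := ht.2; rw [har] at this; exact_mod_cast this
      exact hl2 ⟨by have := (le_max_right _ _).trans htt; linarith, h2⟩

lemma D0_ev {a : EReal} (ha : 0 < a) : ∀ᶠ t in afFilter a, t ∈ D0 a := by
  unfold afFilter
  split_ifs with hT
  · subst hT
    filter_upwards [eventually_gt_atTop 0] with t ht
    exact ⟨ht, EReal.coe_lt_top _⟩
  · have hb : a ≠ ⊥ := by rintro rfl; simp at ha
    have har : a = (a.toReal : EReal) := (EReal.coe_toReal hT hb).symm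
    have hr0 : 0 < a.toReal := by rw [har] at ha; exact_mod_cast ha
    filter_upwards [Ioo_mem_nhdsLT hr0] with t ht
    refine ⟨ht.1, ?_⟩
    rw [har]; exact_mod_cast ht.2

/-- The quantity defining the two limits. -/
def tauAt (f : ℝ → ℝ) (t : ℝ) : ℝ := f t * deriv (deriv f) t / (deriv f t) ^ 2

lemma tauAt_nonneg {a : EReal} {f : ℝ → ℝ} (hf : HypH a f) {t : ℝ} (ht : t ∈ D0 a) :
    0 ≤ tauAt f t :=
  div_nonneg (mul_nonneg (hf.pos t (D0_sub a ht)).le (f''_nonneg hf ht)) (sq_nonneg _)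

lemma tau_tendsto {a : EReal} {f : ℝ → ℝ} (hf : HypH a f)
    (heq : tauMinus a f = tauPlus a f) (hτ0 : 0 < tauPlus a f) :
    Tendsto (tauAt f) (afFilter a) (𝓝 (tauPlus a f)) := by
  refine tendsto_of_liminf_eq_limsup (f := afFilter a) (u := tauAt f) heq rfl ?_ ?_
  · by_contra hcon
    have : {b | ∀ᶠ t in afFilter a, tauAt f t ≤ b} = ∅ := by
      ext b
      simp only [mem_setOf_eq, mem_empty_iff_false, iff_false]
      intro hb
      exact hcon ⟨b, by simpa [eventually_map] using hb⟩
    have h2 : tauPlus a f = sInf {b | ∀ᶠ t in afFilter a, tauAt f t ≤ b} := by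
      exact limsup_eq
    rw [h2, this, Real.sInf_empty] at hτ0
    exact lt_irrefl _ hτ0
  · refine ⟨0, ?_⟩
    rw [eventually_map]
    filter_upwards [D0_ev hf.a_pos] with t ht
    exact tauAt_nonneg hf ht

lemma params {a : EReal} {f : ℝ → ℝ} (hf : HypH a f)
    (heq : tauMinus a f = tauPlus a f) (hτ0 : 0 < tauPlus a f) (hτ1 : tauPlus a f ≤ 1) :
    ∃ β κ γ t1 : ℝ, 1 < β ∧ 0 < κ ∧ β ^ 2 / (2 * β - 1) * κ < 1 ∧ 0 < γ ∧ 5 * γ < 2 * β ∧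
      t1 ∈ D0 a ∧ ∀ t ∈ D0 a, t1 ≤ t → tauAt f t < 2 ∧
        β ^ 2 * (1 - tauAt f t / 2) ^ 2 ≤
          κ * ((2 * β - 1) * (1 - tauAt f t / 2) + tauAt f t / 2) ∧
        tauAt f t ≤ γ * (2 - tauAt f t) := by
  have ht := tau_tendsto hf heq hτ0
  set τ := tauPlus a f
  obtain ⟨β, hβ, hβ2, hP⟩ := exists_beta hτ0 hτ1
  have h2 : 0 < 2 * β - 1 := by linarith
  have hx : 0 < 2 - τ := by linarith
  have hden : 0 < (2 * β - 1) * (1 - τ/2) + τ/2 := by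
    have := mul_pos h2 (show 0 < 1 - τ/2 by linarith); linarith
  obtain ⟨κ, hκ1, hκ2⟩ : ∃ κ, β ^ 2 * (1 - τ/2) ^ 2 / ((2 * β - 1) * (1 - τ/2) + τ/2) < κ ∧
      κ < (2 * β - 1) / β ^ 2 := by
    apply exists_between
    rw [div_lt_div_iff₀ hden (by positivity)]
    nlinarith
  obtain ⟨γ, hγ1, hγ2⟩ : ∃ γ, τ / (2 - τ) < γ ∧ γ < 2 * β / 5 := by
    apply exists_between
    rw [div_lt_div_iff₀ hx (by positivity)]
    linarith
  have hκ0 : 0 < κ := lt_of_le_of_lt (by positivity) hκ1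
  have hγ0 : 0 < γ := lt_of_le_of_lt (by positivity) hγ1
  have e1 : ∀ᶠ T in 𝓝 τ, T < 2 := eventually_lt_nhds (by linarith)
  have e2 : ∀ᶠ T in 𝓝 τ, β ^ 2 * (1 - T / 2) ^ 2 < κ * ((2 * β - 1) * (1 - T / 2) + T / 2) := by
    have c1 : ContinuousAt (fun T : ℝ => β ^ 2 * (1 - T / 2) ^ 2) τ := by fun_prop
    have c2 : ContinuousAt (fun T : ℝ => κ * ((2 * β - 1) * (1 - T / 2) + T / 2)) τ := by fun_prop
    exact c1.eventually_lt c2 ((div_lt_iff₀ hden).1 hκ1)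
  have e3 : ∀ᶠ T in 𝓝 τ, T < γ * (2 - T) := by
    have c1 : ContinuousAt (fun T : ℝ => T) τ := by fun_prop
    have c2 : ContinuousAt (fun T : ℝ => γ * (2 - T)) τ := by fun_prop
    exact c1.eventually_lt c2 ((div_lt_iff₀ hx).1 hγ1)
  obtain ⟨t1, ht1, h⟩ := afFilter_ev hf.a_pos (ht.eventually (e1.and (e2.and e3)))
  refine ⟨β, κ, γ, t1, hβ, hκ0, ?_, hγ0, by linarith, ht1, fun t htD htt => ?_⟩
  · rw [lt_div_iff₀ (by positivity)] at hκ2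
    rw [div_mul_eq_mul_div, div_lt_one h2]; linarith
  · obtain ⟨q1, q2, q3⟩ := h t htD htt
    exact ⟨q1, q2.le, q3.le⟩

/-! ### the function `h = f / √(Df)` -/

/-- The collected parameters. -/
structure PP (a : EReal) (f : ℝ → ℝ) (β κ γ t1 : ℝ) : Prop where
  hf : HypH a f
  hβ : 1 < β
  hκ : 0 < κ
  hκβ : β ^ 2 / (2 * β - 1) * κ < 1
  hγ : 0 < γ
  hγβ : 5 * γ < 2 * β
  ht1 : t1 ∈ D0 a
  hT2 : ∀ t ∈ D0 a, t1 ≤ t → tauAt f t < 2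
  hTκ : ∀ t ∈ D0 a, t1 ≤ t → β ^ 2 * (1 - tauAt f t / 2) ^ 2 ≤
          κ * ((2 * β - 1) * (1 - tauAt f t / 2) + tauAt f t / 2)
  hTγ : ∀ t ∈ D0 a, t1 ≤ t → tauAt f t ≤ γ * (2 - tauAt f t)

/-- `√(Df)`. -/
def sA (f : ℝ → ℝ) (t : ℝ) : ℝ := Real.sqrt (deriv f t)

/-- `f / √(Df)`. -/
def hh (f : ℝ → ℝ) (t : ℝ) : ℝ := f t / Real.sqrt (deriv f t)


lemma sA_pos {a : EReal} {f : ℝ → ℝ} (hf : HypH a f) {t : ℝ} (ht : t ∈ D0 a) : 0 < sA f t :=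
  Real.sqrt_pos.2 (f'_pos hf ht)

lemma sA_mono {a : EReal} {f : ℝ → ℝ} (hf : HypH a f) : MonotoneOn (sA f) (D0 a) :=
  fun _ hx _ hy hxy => Real.sqrt_le_sqrt (f'_mono hf hx hy hxy)

lemma hh_pos {a : EReal} {f : ℝ → ℝ} (hf : HypH a f) {t : ℝ} (ht : t ∈ D0 a) : 0 < hh f t :=
  div_pos (hf.pos t (D0_sub a ht)) (sA_pos hf ht)

lemma f_eq {a : EReal} {f : ℝ → ℝ} (hf : HypH a f) {t : ℝ} (ht : t ∈ D0 a) :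
    f t = sA f t * hh f t := by
  have := sA_pos hf ht
  unfold hh; unfold sA at *; field_simp

lemma hh_cd {a : EReal} {f : ℝ → ℝ} (hf : HypH a f) : ContDiffOn ℝ (⊤ : ℕ∞) (hh f) (D0 a) :=
  (f_cd hf).div ((f'_cd hf).sqrt fun _ ht => (f'_pos hf ht).ne') fun _ ht => (sA_pos hf ht).ne'

lemma sA_cd {a : EReal} {f : ℝ → ℝ} (hf : HypH a f) : ContDiffOn ℝ (⊤ : ℕ∞) (sA f) (D0 a) :=
  (f'_cd hf).sqrt fun _ ht => (f'_pos hf ht).ne'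

lemma sA_deriv {a : EReal} {f : ℝ → ℝ} (hf : HypH a f) {t : ℝ} (ht : t ∈ D0 a) :
    HasDerivAt (sA f) (tauAt f t * sA f t ^ 2 / (2 * hh f t)) t := by
  have h : HasDerivAt (sA f) _ t := (f'_diff hf ht).hasDerivAt.sqrt (f'_pos hf ht).ne'
  refine h.congr_deriv ?_
  have h1 := sA_pos hf ht
  have h2 : sA f t ^ 2 = deriv f t := Real.sq_sqrt (f'_pos hf ht).le
  have h3 := hf.pos t (D0_sub a ht)
  have h4 : Real.sqrt (deriv f t) = sA f t := rfl
  unfold tauAt hh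
  rw [h4, ← h2]
  field_simp

lemma hh_deriv {a : EReal} {f : ℝ → ℝ} (hf : HypH a f) {t : ℝ} (ht : t ∈ D0 a) :
    HasDerivAt (hh f) (sA f t * (1 - tauAt f t / 2)) t := by
  have h1 := sA_pos hf ht
  have h : HasDerivAt (hh f) _ t := (f_diff hf ht).hasDerivAt.div (sA_deriv hf ht) h1.ne'
  refine h.congr_deriv ?_
  have h2 : sA f t ^ 2 = deriv f t := Real.sq_sqrt (f'_pos hf ht).le
  have h3 := hh_pos hf ht
  rw [f_eq hf ht, ← h2, Real.sqrt_sq h1.le]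
  field_simp

lemma Q_deriv {a : EReal} {f : ℝ → ℝ} (hf : HypH a f) (q : ℝ) {t : ℝ} (ht : t ∈ D0 a) :
    HasDerivAt (fun t => hh f t ^ q * sA f t)
      (hh f t ^ (q - 1) * sA f t ^ 2 * (q * (1 - tauAt f t / 2) + tauAt f t / 2)) t := by
  have h1 := sA_pos hf ht
  have h3 := hh_pos hf ht
  have h : HasDerivAt (fun t => hh f t ^ q * sA f t) _ t := ((hh_deriv hf ht).rpow_const (p := q) (Or.inl h3.ne')).mul (sA_deriv hf ht)
  refine h.congr_deriv ?_
  rw [Real.rpow_sub_one h3.ne']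
  field_simp

section SecD
variable {a : EReal} {f : ℝ → ℝ} {β κ γ t1 : ℝ}

lemma convex_I (a : EReal) (t1 : ℝ) : Convex ℝ {t | t ∈ D0 a ∧ t1 ≤ t} :=
  (convex_D0 a).inter (convex_Ici t1)

lemma hh_mono (h : PP a f β κ γ t1) : MonotoneOn (hh f) {t | t ∈ D0 a ∧ t1 ≤ t} := by
  refine monotoneOn_of_deriv_nonneg (convex_I a t1) ?_ ?_ ?_
  · exact (hh_cd h.hf).continuousOn.mono fun t ht => ht.1
  · intro t ht
    exact (hh_deriv h.hf (interior_subset ht).1).differentiableAt.differentiableWithinAt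
  · intro t ht
    have ht := interior_subset ht
    rw [(hh_deriv h.hf ht.1).deriv]
    have := h.hT2 t ht.1 ht.2
    exact mul_nonneg (sA_pos h.hf ht.1).le (by linarith)

lemma sA_le (h : PP a f β κ γ t1) : ∃ C : ℝ, 0 < C ∧ ∀ t ∈ D0 a, t1 ≤ t →
    sA f t ≤ C * hh f t ^ γ := by
  have hanti : AntitoneOn (fun t => hh f t ^ (-γ) * sA f t) {t | t ∈ D0 a ∧ t1 ≤ t} := by
    refine antitoneOn_of_deriv_nonpos (convex_I a t1) ?_ ?_ ?_
    · intro t ht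
      exact (Q_deriv h.hf (-γ) ht.1).continuousAt.continuousWithinAt
    · intro t ht
      exact (Q_deriv h.hf (-γ) (interior_subset ht).1).differentiableAt.differentiableWithinAt
    · intro t ht
      have ht := interior_subset ht
      rw [(Q_deriv h.hf (-γ) ht.1).deriv]
      have h1 := sA_pos h.hf ht.1
      have h3 := hh_pos h.hf ht.1
      have := h.hTγ t ht.1 ht.2
      apply mul_nonpos_of_nonneg_of_nonpos (by positivity)
      linarith
  have h1 := sA_pos h.hf h.ht1
  have h3 := hh_pos h.hf h.ht1
  refine ⟨hh f t1 ^ (-γ) * sA f t1, by positivity, fun t ht htt => ?_⟩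
  have h4 := hanti ⟨h.ht1, le_rfl⟩ ⟨ht, htt⟩ htt
  have h5 := hh_pos h.hf ht
  simp only at h4
  rw [Real.rpow_neg h5.le] at h4
  have h6 : 0 < hh f t ^ γ := by positivity
  calc sA f t = ((hh f t ^ γ)⁻¹ * sA f t) * hh f t ^ γ := by field_simp
    _ ≤ _ := by gcongr

lemma hh_large (h : PP a f β κ γ t1) (B : ℝ) : ∃ t2 ∈ D0 a, ∀ t ∈ D0 a, t2 ≤ t → B < hh f t := by
  obtain ⟨C, hC, hle⟩ := sA_le h
  obtain ⟨t2, ht2, h2⟩ := afFilter_ev h.hf.a_pos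
    (h.hf.blowup.eventually (eventually_gt_atTop (C * |B| ^ γ * |B|)))
  refine ⟨max t1 t2, ?_, fun t ht htt => ?_⟩
  · rcases max_choice t1 t2 with q | q <;> rw [q]
    exacts [h.ht1, ht2]
  · have h3 := h2 t ht ((le_max_right _ _).trans htt)
    by_contra hcon
    rw [not_lt] at hcon
    have h4 := hle t ht ((le_max_left _ _).trans htt)
    have h5 := hh_pos h.hf ht
    have hB : hh f t ≤ |B| := hcon.trans (le_abs_self B)
    rw [f_eq h.hf ht] at h3
    have h6 : sA f t * hh f t ≤ C * |B| ^ γ * |B| := by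
      have : C * hh f t ^ γ ≤ C * |B| ^ γ := by
        gcongr
        exact h.hγ.le
      exact mul_le_mul (h4.trans this) hB h5.le (by positivity)
    linarith
end SecD

/-! ### primitives and truncated powers -/

lemma prim {D : Set ℝ} (hD : IsOpen D) (hc : D.OrdConnected) {g : ℝ → ℝ}
    (hg : ContDiffOn ℝ (⊤ : ℕ∞) g D) {t1 : ℝ} (ht1 : t1 ∈ D) :
    (∀ t ∈ D, HasDerivAt (fun t => ∫ s in t1..t, g s) (g t) t) ∧
      ContDiffOn ℝ (⊤ : ℕ∞) (fun t => ∫ s in t1..t, g s) D := by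
  have h1 : ∀ t ∈ D, HasDerivAt (fun t => ∫ s in t1..t, g s) (g t) t := by
    intro t ht
    have hsub : uIcc t1 t ⊆ D := hc.uIcc_subset ht1 ht
    refine intervalIntegral.integral_hasDerivAt_right
      (hg.continuousOn.mono hsub).intervalIntegrable ?_ (hg.continuousOn.continuousAt (hD.mem_nhds ht))
    exact hg.continuousOn.stronglyMeasurableAtFilter hD t ht
  refine ⟨h1, ?_⟩
  rw [contDiffOn_infty_iff_deriv_of_isOpen hD]
  refine ⟨fun t ht => (h1 t ht).differentiableAt.differentiableWithinAt, ?_⟩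
  exact hg.congr fun t ht => (h1 t ht).deriv

lemma prim_zero {g : ℝ → ℝ} {t1 : ℝ} (h : ∀ t ≤ t1, g t = 0) :
    ∀ t ≤ t1, (∫ s in t1..t, g s) = 0 := by
  intro t ht
  rw [intervalIntegral.integral_congr (g := fun _ => 0)]
  · simp
  · intro s hs
    rw [uIcc_of_ge ht] at hs
    exact h s hs.2

lemma der_cmp {D : Set ℝ} (hc : D.OrdConnected) {F G F' G' : ℝ → ℝ} {t1 : ℝ} (ht1 : t1 ∈ D)
    (hF : ∀ t ∈ D, t1 ≤ t → HasDerivAt F (F' t) t) (hG : ∀ t ∈ D, t1 ≤ t → HasDerivAt G (G' t) t)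
    (hle : ∀ t ∈ D, t1 ≤ t → F' t ≤ G' t) (h1 : F t1 ≤ G t1) : ∀ t ∈ D, t1 ≤ t → F t ≤ G t := by
  have hI : Convex ℝ (D ∩ Ici t1) := hc.convex.inter (convex_Ici t1)
  have hm : MonotoneOn (fun t => G t - F t) (D ∩ Ici t1) := by
    refine monotoneOn_of_deriv_nonneg hI ?_ ?_ ?_
    · intro t ht
      exact ((hG t ht.1 ht.2).sub (hF t ht.1 ht.2)).continuousAt.continuousWithinAt
    · intro t ht
      have ht := interior_subset ht
      exact ((hG t ht.1 ht.2).sub (hF t ht.1 ht.2)).differentiableAt.differentiableWithinAt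
    · intro t ht
      have ht := interior_subset ht
      have h : HasDerivAt (fun t => G t - F t) _ t := (hG t ht.1 ht.2).sub (hF t ht.1 ht.2)
      rw [h.deriv]
      linarith [hle t ht.1 ht.2]
  intro t ht htt
  have := hm ⟨ht1, self_mem_Ici⟩ ⟨ht, htt⟩ htt
  simp only at this
  linarith

/-- derivative of the truncated power -/
def chi' (p s0 r : ℝ) : ℝ := p * r ^ (p - 1) * Real.smoothTransition (r - s0)

/-- truncated power -/
def chi (p s0 s : ℝ) : ℝ := ∫ r in s0..s, chi' p s0 r

/-- the energy function of the truncated power -/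
def chiE (p s0 s : ℝ) : ℝ := ∫ r in s0..s, (deriv (chi p s0) r) ^ 2

section SecE
variable {p s0 : ℝ}

lemma chi'_zero {r : ℝ} (hr : r ≤ s0) : chi' p s0 r = 0 := by
  unfold chi'
  rw [Real.smoothTransition.zero_of_nonpos (by linarith)]; simp

lemma chi'_cd (hs0 : 0 < s0) : ContDiff ℝ (⊤ : ℕ∞) (chi' p s0) := by
  rw [contDiff_iff_contDiffAt]
  intro r
  rcases le_or_gt r 0 with h | h
  · have : chi' p s0 =ᶠ[𝓝 r] fun _ => 0 := by
      filter_upwards [Iio_mem_nhds (h.trans_lt hs0)] with x hx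
      exact chi'_zero (le_of_lt hx)
    exact contDiffAt_const.congr_of_eventuallyEq this
  · unfold chi'
    refine (contDiffAt_const.mul (contDiffAt_id.rpow_const_of_ne h.ne')).mul ?_
    exact (Real.smoothTransition.contDiff.comp (contDiff_id.sub contDiff_const)).contDiffAt

lemma chi'_nonneg (hs0 : 0 < s0) (hp : 1 ≤ p) (r : ℝ) : 0 ≤ chi' p s0 r := by
  rcases le_or_gt r s0 with h | h
  · rw [chi'_zero h]
  · have : 0 < r := hs0.trans h
    have := Real.smoothTransition.nonneg (r - s0)
    unfold chi'; positivity

lemma chi'_le (hp : 1 ≤ p) {r : ℝ} (hr : 0 ≤ r) : chi' p s0 r ≤ p * r ^ (p - 1) := by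
  unfold chi'
  exact mul_le_of_le_one_right (by positivity) (Real.smoothTransition.le_one _)

lemma chi_deriv (hs0 : 0 < s0) (s : ℝ) : HasDerivAt (chi p s0) (chi' p s0 s) s :=
  (prim isOpen_univ ordConnected_univ (chi'_cd hs0).contDiffOn (mem_univ s0)).1 s (mem_univ _)

lemma chi_cd (hs0 : 0 < s0) : ContDiff ℝ (⊤ : ℕ∞) (chi p s0) :=
  contDiffOn_univ.1
    (prim isOpen_univ ordConnected_univ (chi'_cd hs0).contDiffOn (mem_univ s0)).2

lemma chi_zero {s : ℝ} (hs : s ≤ s0) : chi p s0 s = 0 :=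
  prim_zero (fun _ ht => chi'_zero ht) s hs

lemma chi_nonneg (hs0 : 0 < s0) (hp : 1 ≤ p) (s : ℝ) : 0 ≤ chi p s0 s := by
  rcases le_or_gt s s0 with h | h
  · rw [chi_zero h]
  · refine der_cmp (F := fun _ => 0) (F' := fun _ => 0) (G := chi p s0) (G' := chi' p s0) ordConnected_univ
      (mem_univ s0) (fun t _ _ => hasDerivAt_const t 0) (fun t _ _ => chi_deriv hs0 t)
      (fun t _ _ => chi'_nonneg hs0 hp t) (by rw [chi_zero le_rfl]) s (mem_univ _) h.le

lemma chi_le (hs0 : 0 < s0) (hp : 1 ≤ p) {s : ℝ} (hs : 0 ≤ s) : chi p s0 s ≤ s ^ p := by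
  rcases le_or_gt s s0 with h | h
  · rw [chi_zero h]; positivity
  · refine der_cmp (F := chi p s0) (F' := chi' p s0) (G := fun s => s ^ p)
      (G' := fun s => p * s ^ (p - 1)) ordConnected_univ
      (mem_univ s0) (fun t _ _ => chi_deriv hs0 t)
      (fun t _ ht => Real.hasDerivAt_rpow_const (Or.inr hp))
      (fun t _ ht => chi'_le hp (hs0.le.trans ht)) (by rw [chi_zero le_rfl]; positivity) s
      (mem_univ _) h.le

lemma chi_ge (hs0 : 0 < s0) (hp : 1 ≤ p) {s : ℝ} (hs : 0 ≤ s) :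
    s ^ p - (s0 + 1) ^ p ≤ chi p s0 s := by
  have h0 := chi_nonneg hs0 hp
  rcases le_or_gt s (s0 + 1) with h | h
  · have : s ^ p ≤ (s0 + 1) ^ p := by gcongr
    linarith [h0 s]
  · refine der_cmp (F := fun s => s ^ p - (s0 + 1) ^ p) (G := chi p s0) (G' := chi' p s0)
      (F' := fun s => p * s ^ (p - 1)) ordConnected_univ (mem_univ (s0 + 1))
      (fun t _ ht => (Real.hasDerivAt_rpow_const (Or.inr hp)).sub_const _)
      (fun t _ _ => chi_deriv hs0 t)
      (fun t _ ht => ?_) (by simp [h0]) s (mem_univ _) h.le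
    unfold chi'
    rw [Real.smoothTransition.one_of_one_le (by linarith)]; simp

lemma chi_half (hs0 : 0 < s0) (hp : 1 ≤ p) {s : ℝ} (hs : 2 * (s0 + 1) ≤ s) :
    s ^ p ≤ 2 * chi p s0 s := by
  have h1 := chi_ge hs0 hp (s := s) (by linarith)
  have h2 : 2 * (s0 + 1) ^ p ≤ s ^ p := by
    calc 2 * (s0 + 1) ^ p ≤ 2 ^ p * (s0 + 1) ^ p := by
          gcongr
          simpa using Real.rpow_le_rpow_of_exponent_le (one_le_two) hp
      _ = (2 * (s0 + 1)) ^ p := by rw [Real.mul_rpow (by norm_num) (by linarith)]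
      _ ≤ s ^ p := by gcongr
  linarith

lemma deriv_chi (hs0 : 0 < s0) : deriv (chi p s0) = chi' p s0 :=
  funext fun s => (chi_deriv hs0 s).deriv

lemma chiE_prim (hs0 : 0 < s0) : (∀ t, HasDerivAt (chiE p s0) ((deriv (chi p s0) t) ^ 2) t) ∧
    ContDiff ℝ (⊤ : ℕ∞) (chiE p s0) := by
  have hc : ContDiffOn ℝ (⊤ : ℕ∞) (fun r => (deriv (chi p s0) r) ^ 2) univ := by
    rw [deriv_chi hs0]; exact ((chi'_cd hs0).pow 2).contDiffOn
  have := prim isOpen_univ ordConnected_univ hc (mem_univ s0)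
  exact ⟨fun t => this.1 t (mem_univ _), contDiffOn_univ.1 this.2⟩

lemma chiE_zero (hs0 : 0 < s0) {s : ℝ} (hs : s ≤ s0) : chiE p s0 s = 0 :=
  prim_zero (g := fun r => (deriv (chi p s0) r) ^ 2)
    (fun t ht => by rw [deriv_chi hs0, chi'_zero ht]; simp) s hs

lemma sq_rpow_aux {r p : ℝ} (hr : 0 < r) : (p * r ^ (p - 1)) ^ 2 = p ^ 2 * r ^ (2 * p - 2) := by
  rw [mul_pow, ← Real.rpow_natCast (r ^ (p-1)), ← Real.rpow_mul hr.le]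
  congr 2; push_cast; ring

lemma chiE_le (hs0 : 0 < s0) (hp : 1 ≤ p) {s : ℝ} (hs : 0 ≤ s) :
    chiE p s0 s ≤ p ^ 2 / (2 * p - 1) * s ^ (2 * p - 1) := by
  have h2 : 0 < 2 * p - 1 := by linarith
  rcases le_or_gt s s0 with h | h
  · rw [chiE_zero hs0 h]; positivity
  · refine der_cmp (F := chiE p s0) (F' := fun t => (deriv (chi p s0) t) ^ 2)
      (G := fun s => p ^ 2 / (2 * p - 1) * s ^ (2 * p - 1))
      (G' := fun s => p ^ 2 / (2 * p - 1) * ((2 * p - 1) * s ^ (2 * p - 1 - 1))) ordConnected_univ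
      (mem_univ s0) (fun t _ _ => (chiE_prim hs0).1 t)
      (fun t _ ht => (Real.hasDerivAt_rpow_const (Or.inr (by linarith))).const_mul _)
      (fun t _ ht => ?_) (by rw [chiE_zero hs0 le_rfl]; positivity) s
      (mem_univ _) h.le
    have ht0 : 0 < t := hs0.trans_le ht
    rw [deriv_chi hs0]
    calc chi' p s0 t ^ 2 ≤ (p * t ^ (p - 1)) ^ 2 := by
          gcongr
          · exact chi'_nonneg hs0 hp t
          · exact chi'_le hp ht0.le
      _ = p ^ 2 * t ^ (2 * p - 2) := sq_rpow_aux ht0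
      _ = _ := by
        rw [show 2 * p - 1 - 1 = 2 * p - 2 by ring]
        have := h2.ne'
        rw [← mul_assoc, div_mul_cancel₀ _ this]

lemma chiE_nonneg (hs0 : 0 < s0) (s : ℝ) : 0 ≤ chiE p s0 s := by
  rcases le_or_gt s s0 with h | h
  · rw [chiE_zero hs0 h]
  · exact intervalIntegral.integral_nonneg h.le fun r _ => sq_nonneg _

end SecE

/-! ### the test function built from `h(u)` -/

/-- the starting level of the truncation -/
def lev (f : ℝ → ℝ) (t1 : ℝ) : ℝ := hh f t1 + 1

/-- the test function -/
def theta (f : ℝ → ℝ) (t1 p t : ℝ) : ℝ :=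
  if t ≤ t1 then 0 else chi p (lev f t1) (hh f t)

/-- its energy function -/
def ThetaE (f : ℝ → ℝ) (t1 p t : ℝ) : ℝ := ∫ s in t1..t, (deriv (theta f t1 p) s) ^ 2

/-- The set `(-∞, a_f)`. -/
def Dm (a : EReal) : Set ℝ := {t : ℝ | (t : EReal) < a}

section SecF
variable {a : EReal} {f : ℝ → ℝ} {β κ γ t1 p : ℝ}

lemma lev_pos (h : PP a f β κ γ t1) : 0 < lev f t1 := by
  have := hh_pos h.hf h.ht1
  unfold lev; linarith

lemma ordConnected_Dm (a : EReal) : (Dm a).OrdConnected :=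
  ⟨fun _ _ _ hy _ hz => lt_of_le_of_lt (EReal.coe_le_coe_iff.2 hz.2) hy⟩

lemma theta_zero {t : ℝ} (ht : t ≤ t1) : theta f t1 p t = 0 := if_pos ht

lemma theta_loc_zero (h : PP a f β κ γ t1) {t : ℝ} (ht : t ≤ t1) :
    theta f t1 p =ᶠ[𝓝 t] fun _ => 0 := by
  rcases ht.lt_or_eq with h1 | h1
  · filter_upwards [Iio_mem_nhds h1] with x hx
    exact theta_zero (le_of_lt hx)
  · subst h1
    have hc : ContinuousAt (hh f) t := (hh_deriv h.hf h.ht1).continuousAt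
    have : ∀ᶠ x in 𝓝 t, hh f x < lev f t :=
      hc.eventually_lt_const (by unfold lev; linarith)
    filter_upwards [this] with x hx
    unfold theta
    split_ifs
    · rfl
    · exact chi_zero hx.le

lemma theta_loc {t : ℝ} (ht : t1 < t) :
    theta f t1 p =ᶠ[𝓝 t] fun t => chi p (lev f t1) (hh f t) := by
  filter_upwards [Ioi_mem_nhds ht] with x hx
  exact if_neg (not_le.2 hx)

lemma theta_cd (h : PP a f β κ γ t1) : ContDiffOn ℝ (⊤ : ℕ∞) (theta f t1 p) (Dm a) := by
  intro t ht
  apply ContDiffAt.contDiffWithinAt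
  rcases le_or_gt t t1 with h1 | h1
  · exact contDiffAt_const.congr_of_eventuallyEq (theta_loc_zero h h1)
  · refine ContDiffAt.congr_of_eventuallyEq ?_ (theta_loc h1)
    have htD : t ∈ D0 a := ⟨h.ht1.1.trans h1, ht⟩
    exact (chi_cd (lev_pos h)).contDiffAt.comp t
      ((hh_cd h.hf).contDiffAt ((isOpen_D0 a).mem_nhds htD))

lemma theta_deriv (h : PP a f β κ γ t1) {t : ℝ} (ht : t ∈ D0 a) (htt : t1 ≤ t) :
    deriv (theta f t1 p) t = chi' p (lev f t1) (hh f t) * (sA f t * (1 - tauAt f t / 2)) := by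
  rcases htt.eq_or_lt with h1 | h1
  · subst h1
    rw [(theta_loc_zero h le_rfl).deriv_eq, chi'_zero (by unfold lev; linarith)]
    simp
  · rw [(theta_loc h1).deriv_eq]
    exact ((chi_deriv (lev_pos h) (hh f t)).comp t (hh_deriv h.hf ht)).deriv

lemma theta_deriv_zero (h : PP a f β κ γ t1) {t : ℝ} (ht : t ≤ t1) :
    deriv (theta f t1 p) t = 0 := by
  rw [(theta_loc_zero h ht).deriv_eq]; simp

lemma ThetaE_prim (h : PP a f β κ γ t1) :
    (∀ t ∈ Dm a, HasDerivAt (ThetaE f t1 p) ((deriv (theta f t1 p) t) ^ 2) t) ∧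
    ContDiffOn ℝ (⊤ : ℕ∞) (ThetaE f t1 p) (Dm a) :=
  prim (isOpen_ltE a) (ordConnected_Dm a)
    (((theta_cd h).deriv_of_isOpen (isOpen_ltE a) (by norm_cast)).pow 2) h.ht1.2

lemma ThetaE_zero (h : PP a f β κ γ t1) {t : ℝ} (ht : t ≤ t1) : ThetaE f t1 p t = 0 :=
  prim_zero (g := fun r => (deriv (theta f t1 p) r) ^ 2)
    (fun t ht => by rw [theta_deriv_zero h ht]; simp) t ht

lemma ThetaE_le (h : PP a f β κ γ t1) (hp : 1 ≤ p) {c : ℝ} (hc : 0 ≤ c)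
    (hcT : ∀ t ∈ D0 a, t1 ≤ t → p ^ 2 * (1 - tauAt f t / 2) ^ 2 ≤
          c * ((2 * p - 1) * (1 - tauAt f t / 2) + tauAt f t / 2)) :
    ∀ t ∈ D0 a, t1 ≤ t → ThetaE f t1 p t ≤ c * (hh f t ^ (2 * p - 1) * sA f t) := by
  refine der_cmp (F := ThetaE f t1 p) (F' := fun t => (deriv (theta f t1 p) t) ^ 2)
    (G := fun t => c * (hh f t ^ (2 * p - 1) * sA f t))
    (G' := fun t => c * (hh f t ^ (2 * p - 1 - 1) * sA f t ^ 2 *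
      ((2 * p - 1) * (1 - tauAt f t / 2) + tauAt f t / 2)))
    (convex_D0 a).ordConnected h.ht1 (fun t ht _ => (ThetaE_prim h).1 t ht.2)
    (fun t ht _ => (Q_deriv h.hf _ ht).const_mul c) (fun t ht htt => ?_) ?_
  · have hA := sA_pos h.hf ht
    have hH := hh_pos h.hf ht
    rw [theta_deriv h ht htt, mul_pow]
    have h2 : chi' p (lev f t1) (hh f t) ^ 2 ≤ p ^ 2 * hh f t ^ (2 * p - 2) := by
      rw [← sq_rpow_aux hH]
      gcongr
      · exact chi'_nonneg (lev_pos h) hp _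
      · exact chi'_le hp hH.le
    calc _ ≤ (p ^ 2 * hh f t ^ (2 * p - 2)) * (sA f t * (1 - tauAt f t / 2)) ^ 2 := by gcongr
      _ = (hh f t ^ (2 * p - 2) * sA f t ^ 2) * (p ^ 2 * (1 - tauAt f t / 2) ^ 2) := by ring
      _ ≤ (hh f t ^ (2 * p - 2) * sA f t ^ 2) *
          (c * ((2 * p - 1) * (1 - tauAt f t / 2) + tauAt f t / 2)) := by
        exact mul_le_mul_of_nonneg_left (hcT t ht htt) (by positivity)
      _ = _ := by rw [show 2 * p - 1 - 1 = 2 * p - 2 by ring]; ring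
  · rw [ThetaE_zero h le_rfl]
    have := sA_pos h.hf h.ht1
    have := hh_pos h.hf h.ht1
    positivity

lemma ThetaE_le_gen (h : PP a f β κ γ t1) (hp : 1 ≤ p) :
    ∀ t ∈ D0 a, t1 ≤ t → ThetaE f t1 p t ≤ p * (hh f t ^ (2 * p - 1) * sA f t) := by
  refine ThetaE_le h hp (by linarith) fun t ht htt => ?_
  have h1 := h.hT2 t ht htt
  have h2 := tauAt_nonneg h.hf ht
  set T := tauAt f t
  set z := 1 - T/2 with hz
  have hz0 : 0 < z := by linarith
  have hz1 : z ≤ 1 := by linarith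
  have : T/2 = 1 - z := by linarith
  rw [this]
  have hp0 : 0 < p := by linarith
  have e1 : z ^ 2 ≤ z := by nlinarith
  have e2 : p * z ^ 2 ≤ p * z := by gcongr
  have e3 : 0 ≤ (p - 1) * z := by apply mul_nonneg <;> linarith
  nlinarith

lemma ThetaE_le_beta (h : PP a f β κ γ t1) :
    ∀ t ∈ D0 a, t1 ≤ t → ThetaE f t1 β t ≤ κ * (hh f t ^ (2 * β - 1) * sA f t) :=
  ThetaE_le h h.hβ.le h.hκ.le h.hTκ

/-- the scaled negative Laplacian -/
def VV {n : ℕ} (lam : ℝ) (u : EuclideanSpace ℝ (Fin n) → ℝ) (x : EuclideanSpace ℝ (Fin n)) : ℝ :=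
  (-(Real.sqrt lam)⁻¹) * lap u x

lemma VV_cd {n : ℕ} {lam : ℝ} {u : EuclideanSpace ℝ (Fin n) → ℝ} (hu : ContDiff ℝ (⊤ : ℕ∞) u) :
    ContDiff ℝ (⊤ : ℕ∞) (VV lam u) := contDiff_const.mul (contDiff_lap u hu)

variable {n : ℕ} {Ω : Set (EuclideanSpace ℝ (Fin n))} {lam : ℝ}
  {u : EuclideanSpace ℝ (Fin n) → ℝ}

lemma VV_nonneg (hΩ : GoodDomain Ω) (hlam : 0 < lam) (hf : HypH a f) (hs : Solves Ω a lam f u) :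
    ∀ x ∈ Ω, 0 ≤ VV lam u x := by
  intro x hx
  have := v_nonneg hΩ hlam hf hs x hx
  unfold VV
  rw [neg_mul, ← mul_neg]
  positivity

/-- energy identity for `χ_p(V)` -/
lemma energy_V (hΩ : GoodDomain Ω) (hlam : 0 < lam) (h : PP a f β κ γ t1)
    (hs : Solves Ω a lam f u) (p : ℝ) :
    ∃ φ : EuclideanSpace ℝ (Fin n) → ℝ, ContDiff ℝ (⊤ : ℕ∞) φ ∧ HasCompactSupport φ ∧
      tsupport φ ⊆ Ω ∧ (∀ x ∈ Ω, φ x = chi p (lev f t1) (VV lam u x)) ∧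
      ∫ x in Ω, ‖gradient φ x‖ ^ 2 =
        Real.sqrt lam * ∫ x in Ω, chiE p (lev f t1) (VV lam u x) * f (u x) := by
  have hV : ContDiff ℝ (⊤ : ℕ∞) (VV lam u) := VV_cd hs.1
  have hVf : ∀ x ∈ frontier Ω, VV lam u x = 0 := fun x hx => by
    unfold VV; rw [hs.2.2.2.2 x hx, mul_zero]
  have hl := lev_pos h
  obtain ⟨a1, a2, a3⟩ := ind_smooth hΩ.1 hΩ.2.1 hV hVf isOpen_univ (fun x _ => mem_univ _)
    (chi_cd (p := p) hl).contDiffOn hl (fun t ht => chi_zero ht)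
  refine ⟨_, a1, a2, a3, fun x hx => indicator_of_mem hx _, ?_⟩
  rw [energy_identity hΩ.1 hΩ.2.1 hV hVf isOpen_univ (fun x _ => mem_univ _)
    (chi_cd (p := p) hl).contDiffOn (chiE_prim (p := p) hl).2.contDiffOn hl (fun t ht => chi_zero ht)
    (fun t ht => chiE_zero hl ht) (fun t _ => (chiE_prim hl).1 t), ← integral_const_mul]
  refine setIntegral_congr_fun hΩ.1.measurableSet fun x hx => ?_
  have hsq := Real.sqrt_pos.2 hlam
  have : lap (VV lam u) x = (-(Real.sqrt lam)⁻¹) * lap (lap u) x :=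
    lap_neg (contDiff_lap u hs.1) _ x
  rw [this, hs.2.2.1 x hx]
  have e : lam = Real.sqrt lam * Real.sqrt lam := (Real.mul_self_sqrt hlam.le).symm
  have e2 : -(-(Real.sqrt lam)⁻¹ * (lam * f (u x))) = Real.sqrt lam * f (u x) := by
    calc _ = (Real.sqrt lam)⁻¹ * ((Real.sqrt lam * Real.sqrt lam) * f (u x)) := by rw [← e]; ring
      _ = _ := by field_simp
  rw [e2]; ring

/-- energy identity for `χ_p(h(u))` -/
lemma energy_H (hΩ : GoodDomain Ω) (hlam : 0 < lam) (h : PP a f β κ γ t1)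
    (hs : Solves Ω a lam f u) (p : ℝ) :
    ∃ φ : EuclideanSpace ℝ (Fin n) → ℝ, ContDiff ℝ (⊤ : ℕ∞) φ ∧ HasCompactSupport φ ∧
      tsupport φ ⊆ Ω ∧ (∀ x ∈ Ω, φ x = theta f t1 p (u x)) ∧
      ∫ x in Ω, ‖gradient φ x‖ ^ 2 =
        Real.sqrt lam * ∫ x in Ω, ThetaE f t1 p (u x) * VV lam u x := by
  have hD : ∀ x ∈ Ω, u x ∈ Dm a := fun x hx => (hs.2.1 x hx).2
  obtain ⟨a1, a2, a3⟩ := ind_smooth hΩ.1 hΩ.2.1 hs.1 hs.2.2.2.1 (isOpen_ltE a) hD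
    (theta_cd (p := p) h) h.ht1.1 (fun t ht => theta_zero ht)
  refine ⟨_, a1, a2, a3, fun x hx => indicator_of_mem hx _, ?_⟩
  rw [energy_identity hΩ.1 hΩ.2.1 hs.1 hs.2.2.2.1 (isOpen_ltE a) hD
    (theta_cd (p := p) h) (ThetaE_prim (p := p) h).2 h.ht1.1 (fun t ht => theta_zero ht)
    (fun t ht => ThetaE_zero h ht) (ThetaE_prim h).1, ← integral_const_mul]
  refine setIntegral_congr_fun hΩ.1.measurableSet fun x hx => ?_
  have hsq := Real.sqrt_pos.2 hlam
  unfold VV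
  field_simp
end SecF

/-! ### Stage 1: pointwise inequalities -/

section SecG
variable {a : EReal} {f : ℝ → ℝ} {β κ γ t1 p s0 : ℝ}

lemma rearr {m g v : ℝ} (hm : 0 < m) (hg : 0 ≤ g) (hv : 0 ≤ v) :
    g * v ^ m + g ^ m * v ≤ v ^ (m + 1) + g ^ (m + 1) := by
  have e : ∀ x : ℝ, 0 ≤ x → x ^ (m + 1) = x ^ m * x := fun x hx => by
    rw [Real.rpow_add' hx (by linarith), Real.rpow_one]
  rw [e v hv, e g hg]
  rcases le_total g v with h | h
  · have := Real.rpow_le_rpow hg h hm.le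
    nlinarith [mul_nonneg (sub_nonneg.2 h) (sub_nonneg.2 this)]
  · have := Real.rpow_le_rpow hv h hm.le
    nlinarith [mul_nonneg (sub_nonneg.2 h) (sub_nonneg.2 this)]

lemma young_pair {κ1 κ : ℝ} (h1 : 0 < κ1) (h2 : 0 < κ) (hβ : 1 < β) :
    ∃ R : ℝ, 0 < R ∧ ∀ g v : ℝ, 0 ≤ g → 0 ≤ v →
      κ1 * (g * v ^ (2 * β - 1)) + R * (κ * (g ^ (2 * β - 1) * v)) ≤
        Real.sqrt (κ1 * κ) * (v ^ (2 * β) + R * g ^ (2 * β)) := by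
  set ρ := Real.sqrt (κ / κ1) with hρ
  have hρ0 : 0 < ρ := Real.sqrt_pos.2 (by positivity)
  have hq : Real.sqrt (κ1 * κ) = κ1 * ρ := by
    rw [hρ, show κ1 * κ = κ1 ^ 2 * (κ / κ1) by field_simp, Real.sqrt_mul (by positivity),
      Real.sqrt_sq h1.le]
  have hρ2 : κ = κ1 * ρ * ρ := by
    have : ρ * ρ = κ / κ1 := Real.mul_self_sqrt (by positivity)
    rw [mul_assoc, this]; field_simp
  refine ⟨ρ ^ (-(2 * β)), by positivity, fun g v hg hv => ?_⟩
  have hr := rearr (m := 2 * β - 1) (by linarith) (div_nonneg hg hρ0.le) hv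
  rw [show 2 * β - 1 + 1 = 2 * β by ring, Real.div_rpow hg hρ0.le, Real.div_rpow hg hρ0.le] at hr
  rw [hq, Real.rpow_neg hρ0.le]
  have e1 : ρ ^ (2 * β - 1) = ρ ^ (2 * β) / ρ := Real.rpow_sub_one hρ0.ne' _
  rw [e1] at hr
  have hP : 0 < ρ ^ (2 * β) := by positivity
  set P := ρ ^ (2 * β)
  have hr2 := mul_le_mul_of_nonneg_left hr (by positivity : 0 ≤ κ1 * ρ)
  calc _ = κ1 * ρ * (g / ρ * v ^ (2 * β - 1) + g ^ (2 * β - 1) / (P / ρ) * v) := by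
        rw [hρ2]; field_simp
    _ ≤ _ := hr2
    _ = _ := by field_simp

lemma chi_abs (hs0 : 0 < s0) (hβ : 1 < β) {q q' : ℝ} (hq : 0 ≤ q) (hqq : q < q') :
    ∃ C : ℝ, 0 ≤ C ∧ ∀ s, 0 ≤ s → q * s ^ (2 * β) ≤ q' * chi β s0 s ^ 2 + C := by
  set k := (s0 + 1) ^ β
  have hk : 0 ≤ k := by positivity
  have hd : 0 < q' - q := by linarith
  refine ⟨q * k ^ 2 + q' ^ 2 * k ^ 2 / (q' - q), by positivity, fun s hs => ?_⟩
  have h1 := chi_ge (s0 := s0) hs0 hβ.le hs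
  have h2 := chi_nonneg (s0 := s0) hs0 hβ.le s
  have e : s ^ (2 * β) = (s ^ β) ^ 2 := by
    rw [← Real.rpow_natCast, ← Real.rpow_mul hs]; congr 1; push_cast; ring
  rw [e]
  have hy : 0 ≤ s ^ β := by positivity
  change s ^ β - k ≤ _ at h1
  set y := s ^ β
  set c := chi β s0 s
  rcases le_or_gt y k with h3 | h3
  · have : q * y ^ 2 ≤ q * k ^ 2 := by gcongr
    have : 0 ≤ q' * c ^ 2 := mul_nonneg (by linarith) (sq_nonneg _)
    have : 0 ≤ q' ^ 2 * k ^ 2 / (q' - q) := by positivity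
    linarith
  · have h4 : (y - k) ^ 2 ≤ c ^ 2 := by
      have : 0 ≤ y - k := by linarith
      gcongr
    have h5 : q' * (y - k) ^ 2 ≤ q' * c ^ 2 := by
      apply mul_le_mul_of_nonneg_left h4; linarith
    have h6 : q * y ^ 2 ≤ q' * (y - k) ^ 2 + q' ^ 2 * k ^ 2 / (q' - q) := by
      have : q' * (y - k) ^ 2 + q' ^ 2 * k ^ 2 / (q' - q) - q * y ^ 2 =
        ((q' - q) * y - q' * k) ^ 2 / (q' - q) + q' * k ^ 2 := by field_simp; ring
      have h7 : 0 ≤ ((q' - q) * y - q' * k) ^ 2 / (q' - q) := by positivity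
      have : 0 ≤ q' * k ^ 2 := mul_nonneg (by linarith) (sq_nonneg _)
      linarith
    have : 0 ≤ q * k ^ 2 := by positivity
    linarith

lemma chi_sub (hs0 : 0 < s0) (hβ : 1 < β) {c ε : ℝ} (hc : 0 ≤ c) (hε : 0 < ε) :
    ∃ C : ℝ, 0 ≤ C ∧ ∀ s, 0 ≤ s → c * s ^ (2 * β - 1) ≤ ε * chi β s0 s ^ 2 + C := by
  obtain ⟨C, hC, h⟩ := chi_abs hs0 hβ (q := ε/2) (q' := ε) (by positivity) (by linarith)
  set B := 2 * c / ε
  have hB : 0 ≤ B := by positivity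
  refine ⟨C + c * B ^ (2 * β - 1), by positivity, fun s hs => ?_⟩
  rcases le_or_gt s B with h1 | h1
  · have : c * s ^ (2 * β - 1) ≤ c * B ^ (2 * β - 1) := by
      gcongr; linarith
    have : 0 ≤ ε * chi β s0 s ^ 2 := by positivity
    linarith
  · have hs0 : 0 < s := by linarith
    have h2 : c ≤ ε/2 * s := by
      rw [div_lt_iff₀ hε] at h1; linarith
    have h3 : c * s ^ (2 * β - 1) ≤ ε/2 * s ^ (2 * β) := by
      rw [Real.rpow_sub_one hs0.ne']
      calc c * (s ^ (2 * β) / s) ≤ (ε/2 * s) * (s ^ (2 * β) / s) := by gcongr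
        _ = _ := by field_simp
    have : 0 ≤ c * B ^ (2 * β - 1) := by positivity
    linarith [h s hs]

lemma sA_absorb (h : PP a f β κ γ t1) {c ε : ℝ} (hc : 0 ≤ c) (hε : 0 < ε) :
    ∃ C : ℝ, 0 ≤ C ∧ ∀ t ∈ D0 a, t1 < t →
      sA f t * c ≤ ε * (sA f t * theta f t1 β t ^ 2) + C := by
  have hl := lev_pos h
  obtain ⟨C1, hC1, hle⟩ := sA_le h
  obtain ⟨C2, hC2, h2⟩ := chi_abs hl h.hβ (q := ε/2) (q' := ε) (by positivity) (by linarith)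
  set B := max 1 (2 * (c + C2) / ε)
  have hB : 1 ≤ B := le_max_left _ _
  refine ⟨C1 * B ^ γ * c, by positivity, fun t ht htt => ?_⟩
  have hA := sA_pos h.hf ht
  have hH := hh_pos h.hf ht
  have hth : theta f t1 β t = chi β (lev f t1) (hh f t) := if_neg (not_le.2 htt)
  rw [hth]
  rcases le_or_gt (hh f t) B with h1 | h1
  · have h3 : sA f t ≤ C1 * B ^ γ := (hle t ht htt.le).trans (by gcongr; exact h.hγ.le)
    have : sA f t * c ≤ C1 * B ^ γ * c := by gcongr
    have : 0 ≤ ε * (sA f t * chi β (lev f t1) (hh f t) ^ 2) := by positivity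
    linarith
  · have h3 := h2 (hh f t) hH.le
    have h4 : 2 * (c + C2) / ε ≤ hh f t := (le_max_right _ _).trans h1.le
    rw [div_le_iff₀ hε] at h4
    have h5 : hh f t ≤ hh f t ^ (2 * β) := by
      have h6 : 1 ≤ hh f t := by linarith
      have := Real.rpow_le_rpow_of_exponent_le h6 (show (1:ℝ) ≤ 2 * β by linarith [h.hβ])
      simpa using this
    have h7 : c ≤ ε * chi β (lev f t1) (hh f t) ^ 2 := by nlinarith
    have h8 := mul_le_mul_of_nonneg_left h7 hA.le
    have : 0 ≤ C1 * B ^ γ * c := by positivity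
    linarith

lemma pw1 (h : PP a f β κ γ t1) : ∃ R η : ℝ, 0 < R ∧ 0 < η ∧ η < 1 ∧ ∀ ε > 0, ∃ C : ℝ, 0 ≤ C ∧
    ∀ t ∈ domf a, ∀ v, 0 ≤ v →
      chiE β (lev f t1) v * f t + R * (ThetaE f t1 β t * v) ≤
        (1 - η) * (sA f t * chi β (lev f t1) v ^ 2 + R * (sA f t * theta f t1 β t ^ 2)) +
        ε * chi β (lev f t1) v ^ 2 + C := by
  have hl := lev_pos h
  have hβ := h.hβ
  set κ1 := β ^ 2 / (2 * β - 1) with hκ1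
  have h2β : 0 < 2 * β - 1 := by linarith
  have hκ10 : 0 < κ1 := by positivity
  obtain ⟨R, hR, hy⟩ := young_pair hκ10 h.hκ hβ
  set q := Real.sqrt (κ1 * κ)
  have hq0 : 0 ≤ q := Real.sqrt_nonneg _
  have hq1 : q < 1 := by
    rw [Real.sqrt_lt' one_pos]; simpa using h.hκβ
  set η := (1 - q) / 4 with hη
  have hη0 : 0 < η := by linarith
  obtain ⟨C1, hC1, h1⟩ := chi_abs hl hβ (q := q) (q' := 1 - 2 * η) hq0 (by linarith)
  obtain ⟨C2, hC2, h2⟩ := sA_absorb h (c := C1 * (1 + R)) (ε := η * R) (by positivity) (by positivity)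
  refine ⟨R, η, hR, hη0, by linarith, fun ε hε => ?_⟩
  have hft1 := h.hf.pos t1 (D0_sub a h.ht1)
  obtain ⟨C3, hC3, h3⟩ := chi_sub hl hβ (c := κ1 * f t1) (ε := ε) (by positivity) hε
  refine ⟨C2 + C3, by positivity, fun t ht v hv => ?_⟩
  have hA : 0 ≤ sA f t := Real.sqrt_nonneg _
  have hE := chiE_le hl hβ.le hv
  have hft := h.hf.pos t ht
  have hεχ : 0 ≤ ε * chi β (lev f t1) v ^ 2 := by positivity
  rcases le_or_gt t t1 with htt | htt
  · rw [ThetaE_zero h htt, theta_zero htt]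
    have hff : f t ≤ f t1 := h.hf.mono.monotoneOn ht (D0_sub a h.ht1) htt
    have e1 : chiE β (lev f t1) v * f t ≤ κ1 * v ^ (2 * β - 1) * f t1 :=
      mul_le_mul hE hff hft.le (by positivity)
    have e2 : 0 ≤ (1 - η) * (sA f t * chi β (lev f t1) v ^ 2) := by
      apply mul_nonneg (by linarith); positivity
    have := h3 v hv
    simp only [zero_mul, mul_zero, ne_eq, OfNat.ofNat_ne_zero, not_false_eq_true, zero_pow, add_zero]
    nlinarith
  · have htD : t ∈ D0 a := ⟨h.ht1.1.trans htt, ht.2⟩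
    have hH := hh_pos h.hf htD
    have hth : theta f t1 β t = chi β (lev f t1) (hh f t) := if_neg (not_le.2 htt)
    have e1 : chiE β (lev f t1) v * f t ≤ κ1 * v ^ (2 * β - 1) * (sA f t * hh f t) := by
      rw [f_eq h.hf htD]; gcongr
    have e2 : ThetaE f t1 β t * v ≤ κ * (hh f t ^ (2 * β - 1) * sA f t) * v := by
      gcongr; exact ThetaE_le_beta h t htD htt.le
    have e3 := mul_le_mul_of_nonneg_left (hy (hh f t) v hH.le hv) hA
    have e4 := mul_le_mul_of_nonneg_left (h1 v hv) hA
    have e5 := mul_le_mul_of_nonneg_left (h1 (hh f t) hH.le) (mul_nonneg hA hR.le)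
    have e6 := h2 t htD htt
    have e7 : 0 ≤ η * (sA f t * chi β (lev f t1) v ^ 2) := by positivity
    have e8 := mul_le_mul_of_nonneg_left e2 hR.le
    rw [hth] at *
    nlinarith
end SecG

/-! ### bounded measurable functions -/

/-- bounded and measurable on `Ω` -/
def BM {n : ℕ} (Ω : Set (EuclideanSpace ℝ (Fin n))) (g : EuclideanSpace ℝ (Fin n) → ℝ) : Prop :=
  AEStronglyMeasurable g (volume.restrict Ω) ∧ ∃ B, ∀ x ∈ Ω, |g x| ≤ B

section SecH
variable {n : ℕ} {Ω : Set (EuclideanSpace ℝ (Fin n))} {g k : EuclideanSpace ℝ (Fin n) → ℝ}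

lemma BM.int (hΩ : GoodDomain Ω) (h : BM Ω g) : IntegrableOn g Ω := by
  obtain ⟨B, hB⟩ := h.2
  exact bdd_integrableOn hΩ h.1 hB

lemma BM.mul (hg : BM Ω g) (hk : BM Ω k) : BM Ω (fun x => g x * k x) := by
  obtain ⟨B, hB⟩ := hg.2
  obtain ⟨B', hB'⟩ := hk.2
  refine ⟨hg.1.mul hk.1, B * B', fun x hx => ?_⟩
  rw [abs_mul]
  exact mul_le_mul (hB x hx) (hB' x hx) (abs_nonneg _) ((abs_nonneg _).trans (hB x hx))

lemma BM.add (hg : BM Ω g) (hk : BM Ω k) : BM Ω (fun x => g x + k x) := by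
  obtain ⟨B, hB⟩ := hg.2
  obtain ⟨B', hB'⟩ := hk.2
  exact ⟨hg.1.add hk.1, B + B', fun x hx => (abs_add_le _ _).trans (add_le_add (hB x hx) (hB' x hx))⟩

lemma BM.const (c : ℝ) : BM Ω (fun _ => c) := ⟨aestronglyMeasurable_const, |c|, fun _ _ => le_rfl⟩

lemma BM.sq (hg : BM Ω g) : BM Ω (fun x => g x ^ 2) := by
  simpa only [pow_two] using hg.mul hg

lemma BM.cmul (c : ℝ) (hg : BM Ω g) : BM Ω (fun x => c * g x) := (BM.const c).mul hg

/-- composition with a function that is continuous on a closed set containing the values -/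
lemma BM.comp {F : ℝ → ℝ} (hF : Continuous F) (hg : BM Ω g) : BM Ω (fun x => F (g x)) := by
  obtain ⟨B, hB⟩ := hg.2
  refine ⟨hF.comp_aestronglyMeasurable hg.1, ?_⟩
  obtain ⟨C, hC⟩ := (isCompact_Icc (a := -B) (b := B)).exists_bound_of_continuousOn hF.continuousOn
  exact ⟨C, fun x hx => hC _ (abs_le.1 (hB x hx))⟩

lemma BM.max (hg : BM Ω g) (hk : BM Ω k) : BM Ω (fun x => max (g x) (k x)) := by
  obtain ⟨B, hB⟩ := hg.2
  obtain ⟨B', hB'⟩ := hk.2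
  refine ⟨hg.1.sup hk.1, Max.max B B', fun x hx => ?_⟩
  change |Max.max (g x) (k x)| ≤ _
  rcases max_choice (g x) (k x) with h | h <;> rw [h]
  exacts [(hB x hx).trans (le_max_left _ _), (hB' x hx).trans (le_max_right _ _)]

lemma BM.of_continuous (hΩ : GoodDomain Ω) (hg : Continuous g) : BM Ω g := by
  refine ⟨hg.aestronglyMeasurable, ?_⟩
  obtain ⟨C, hC⟩ := hΩ.2.1.isCompact_closure.exists_bound_of_continuousOn hg.continuousOn
  exact ⟨C, fun x hx => hC x (subset_closure hx)⟩

variable {a : EReal} {f : ℝ → ℝ} {β κ γ t1 p : ℝ} {lam : ℝ} {u : EuclideanSpace ℝ (Fin n) → ℝ}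

lemma BM.of_u (hΩ : GoodDomain Ω) (ha : 0 < a) (hs : Solves Ω a lam f u) {F : ℝ → ℝ}
    (hF : ContinuousOn F (domf a)) : BM Ω (fun x => F (u x)) := by
  obtain ⟨T, hT, hle⟩ := sol_le hΩ ha hs
  have hsub : Icc 0 T ⊆ domf a := fun t ht =>
    ⟨ht.1, lt_of_le_of_lt (EReal.coe_le_coe_iff.2 ht.2) hT.2⟩
  refine ⟨?_, ?_⟩
  · exact (hF.comp hs.1.continuous.continuousOn (fun x hx => hs.2.1 x hx)).aestronglyMeasurable
      hΩ.1.measurableSet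
  · obtain ⟨C, hC⟩ := isCompact_Icc.exists_bound_of_continuousOn (hF.mono hsub)
    exact ⟨C, fun x hx => hC _ ⟨(hs.2.1 x hx).1, hle x hx⟩⟩

lemma BM.sA (hΩ : GoodDomain Ω) (hf : HypH a f) (hs : Solves Ω a lam f u) :
    BM Ω (fun x => sA f (u x)) := by
  obtain ⟨B, hB⟩ := sqrt_f'_bdd hΩ hf hs
  refine ⟨(meas_sqrt_f' f hs.1.continuous).aestronglyMeasurable, B, fun x hx => ?_⟩
  change |Real.sqrt (deriv f (u x))| ≤ _
  rw [abs_of_nonneg (Real.sqrt_nonneg _)]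
  exact hB x hx

lemma domf_sub_Dm : domf a ⊆ Dm a := fun _ h => h.2

lemma stage1 (hn1 : 1 ≤ n) (hn : n ≤ 12) (hΩ : GoodDomain Ω) (h : PP a f β κ γ t1) :
    ∃ C : ℝ, ∀ (lam : ℝ) (u : EuclideanSpace ℝ (Fin n) → ℝ), 0 < lam →
      Solves Ω a lam f u → StabIneq Ω lam f u →
      ∫ x in Ω, sA f (u x) * chi β (lev f t1) (VV lam u x) ^ 2 ≤ C ∧
      ∫ x in Ω, sA f (u x) * theta f t1 β (u x) ^ 2 ≤ C ∧
      ∫ x in Ω, chi β (lev f t1) (VV lam u x) ^ 2 ≤ C := by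
  have hl := lev_pos h
  have hf := h.hf
  obtain ⟨M, hM, hMb⟩ := mu_bound hn1 hΩ hf
  obtain ⟨P, hP, hPb⟩ := poinc_real hn1 hn hΩ.2.1 hΩ.1.measurableSet
  obtain ⟨R, η, hR, hη, hη1, hpw⟩ := pw1 h
  have hPM : 0 < P * M := by positivity
  obtain ⟨C, hC, hpw⟩ := hpw (η / (2 * (P * M))) (by positivity)
  set K := C * volume.real Ω with hK
  set J0 := 2 * K / η
  refine ⟨max J0 (max (J0 / R) (P * M * J0)), fun lam u hlam hs hst => ?_⟩
  have hμ := Real.sqrt_pos.2 hlam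
  have hμM := hMb lam u hlam hs hst
  have hV0 := VV_nonneg hΩ hlam hf hs
  have bV : BM Ω (VV lam u) := .of_continuous hΩ (VV_cd hs.1).continuous
  have bχ : BM Ω (fun x => chi β (lev f t1) (VV lam u x)) := bV.comp (chi_cd hl).continuous
  have bE : BM Ω (fun x => chiE β (lev f t1) (VV lam u x)) := bV.comp (chiE_prim hl).2.continuous
  have bf : BM Ω (fun x => f (u x)) := .of_u hΩ hf.a_pos hs hf.smooth.continuousOn
  have bθ : BM Ω (fun x => theta f t1 β (u x)) :=
    .of_u hΩ hf.a_pos hs ((theta_cd h).continuousOn.mono domf_sub_Dm)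
  have bΘ : BM Ω (fun x => ThetaE f t1 β (u x)) :=
    .of_u hΩ hf.a_pos hs ((ThetaE_prim h).2.continuousOn.mono domf_sub_Dm)
  have bA := BM.sA hΩ hf hs
  obtain ⟨φ, q1, q2, q3, q4, q5⟩ := energy_V hΩ hlam h hs β
  obtain ⟨ψ, r1, r2, r3, r4, r5⟩ := energy_H hΩ hlam h hs β
  have s1 := hst φ q1 q2 q3
  have s2 := hst ψ r1 r2 r3
  have s3 := hPb φ q1 q2 q3
  have hm := hΩ.1.measurableSet
  rw [q5, setIntegral_congr_fun hm (g := fun x => sA f (u x) * chi β (lev f t1) (VV lam u x) ^ 2)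
    (fun x hx => by simp only [q4 x hx]; rfl)] at s1
  rw [r5, setIntegral_congr_fun hm (g := fun x => sA f (u x) * theta f t1 β (u x) ^ 2)
    (fun x hx => by simp only [r4 x hx]; rfl)] at s2
  rw [q5, setIntegral_congr_fun hm (g := fun x => chi β (lev f t1) (VV lam u x) ^ 2)
    (fun x hx => by simp only [q4 x hx])] at s3
  have s1 := le_of_mul_le_mul_left s1 hμ
  have s2 := le_of_mul_le_mul_left s2 hμ
  set I1 := ∫ x in Ω, sA f (u x) * chi β (lev f t1) (VV lam u x) ^ 2
  set I2 := ∫ x in Ω, sA f (u x) * theta f t1 β (u x) ^ 2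
  set I3 := ∫ x in Ω, chi β (lev f t1) (VV lam u x) ^ 2
  set JE := ∫ x in Ω, chiE β (lev f t1) (VV lam u x) * f (u x)
  set JT := ∫ x in Ω, ThetaE f t1 β (u x) * VV lam u x
  have hI1 : 0 ≤ I1 := setIntegral_nonneg hm fun x _ => mul_nonneg (Real.sqrt_nonneg _) (sq_nonneg _)
  have hI2 : 0 ≤ I2 := setIntegral_nonneg hm fun x _ => mul_nonneg (Real.sqrt_nonneg _) (sq_nonneg _)
  have hint : JE + R * JT ≤ (1 - η) * (I1 + R * I2) + η / (2 * (P * M)) * I3 + K := by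
    have e1 : JE + R * JT = ∫ x in Ω, (chiE β (lev f t1) (VV lam u x) * f (u x) +
        R * (ThetaE f t1 β (u x) * VV lam u x)) := by
      rw [integral_add ((bE.mul bf).int hΩ) (((bΘ.mul bV).cmul R).int hΩ), integral_const_mul]
    have e2 : (1 - η) * (I1 + R * I2) + η / (2 * (P * M)) * I3 + K =
        ∫ x in Ω, ((1 - η) * (sA f (u x) * chi β (lev f t1) (VV lam u x) ^ 2 +
          R * (sA f (u x) * theta f t1 β (u x) ^ 2)) +
        η / (2 * (P * M)) * chi β (lev f t1) (VV lam u x) ^ 2 + C) := by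
      have b1 := bA.mul bχ.sq
      have b2 := (bA.mul bθ.sq).cmul R
      have b3 := (b1.add b2).cmul (1 - η)
      have b4 := bχ.sq.cmul (η / (2 * (P * M)))
      rw [integral_add ((b3.add b4).int hΩ) ((BM.const C).int hΩ), integral_add (b3.int hΩ) (b4.int hΩ),
        integral_const_mul, integral_const_mul, integral_add (b1.int hΩ) (b2.int hΩ),
        integral_const_mul, setIntegral_const, hK, smul_eq_mul, mul_comm C]
    rw [e1, e2]
    refine setIntegral_mono_on (((bE.mul bf).add ((bΘ.mul bV).cmul R)).int hΩ) ?_ hm ?_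
    · exact (((((bA.mul bχ.sq).add ((bA.mul bθ.sq).cmul R)).cmul (1 - η)).add
        (bχ.sq.cmul _)).add (BM.const C)).int hΩ
    · intro x hx
      exact hpw (u x) (hs.2.1 x hx) (VV lam u x) (hV0 x hx)
  have hJE : 0 ≤ JE := hI1.trans s1
  have hJT : 0 ≤ JT := hI2.trans s2
  set J := JE + R * JT with hJ
  have hRJT := mul_nonneg hR.le hJT
  have hI3 : I3 ≤ P * M * J := by
    calc I3 ≤ P * (Real.sqrt lam * JE) := s3
      _ ≤ P * (M * J) := by gcongr; linarith
      _ = _ := by ring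
  have hJ0 : J ≤ J0 := by
    have e1 : η / (2 * (P * M)) * I3 ≤ η / 2 * J := by
      calc _ ≤ η / (2 * (P * M)) * (P * M * J) := by gcongr
        _ = _ := by field_simp
    have e2 : (1 - η) * (I1 + R * I2) ≤ (1 - η) * J := by
      apply mul_le_mul_of_nonneg_left _ (by linarith)
      have := mul_le_mul_of_nonneg_left s2 hR.le
      linarith
    rw [le_div_iff₀ hη]; nlinarith
  refine ⟨le_max_of_le_left (by linarith), le_max_of_le_right (le_max_of_le_left ?_),
    le_max_of_le_right (le_max_of_le_right ?_)⟩
  · rw [le_div_iff₀ hR]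
    have := mul_le_mul_of_nonneg_left s2 hR.le
    linarith
  · exact hI3.trans (by gcongr)
end SecH

/-! ### Moser iteration, abstract part -/

lemma iter_bound {Y : ℕ → ℝ} {c : ℝ} (hc : 1 ≤ c) (hY : ∀ k, 0 ≤ Y k)
    (hstep : ∀ k, Y (k + 1) ≤ (c * (6/5) ^ k * Y k) ^ (6/5 : ℝ)) {N : ℝ}
    (hN : (c * (6/5) ^ 5) ^ 6 * Y 0 ≤ N) : ∀ k : ℕ, Y k ≤ N ^ (((6:ℝ)/5) ^ k) := by
  set d : ℕ → ℝ := fun k => c * (6/5) ^ (k + 5) with hd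
  have hd1 : ∀ k, 1 ≤ d k := fun k => by
    have : (1:ℝ) ≤ (6/5) ^ (k + 5) := one_le_pow₀ (by norm_num)
    show 1 ≤ c * (6/5) ^ (k + 5)
    nlinarith
  have h6 : ∀ x : ℝ, 0 ≤ x → (x ^ 5) ^ (6/5 : ℝ) = x ^ 6 := fun x hx => by
    rw [← Real.rpow_natCast x 5, ← Real.rpow_mul hx, ← Real.rpow_natCast x 6]; norm_num
  have hN0 : 0 ≤ N := le_trans (mul_nonneg (by positivity) (hY 0)) hN
  have main : ∀ k : ℕ, d k ^ 6 * Y k ≤ N ^ (((6:ℝ)/5) ^ k) := by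
    intro k
    induction k with
    | zero => simpa [hd] using hN
    | succ k ih =>
      have hdk := hd1 k
      have e1 : d (k + 1) = 6/5 * d k := by simp only [hd]; ring
      have e2 : c * (6/5) ^ k = d k * (5/6) ^ 5 := by
        simp only [hd, pow_add]; ring
      have hYk := hY k
      have hdk0 : 0 ≤ d k := by linarith
      calc d (k + 1) ^ 6 * Y (k + 1) ≤ d (k + 1) ^ 6 * (c * (6/5) ^ k * Y k) ^ (6/5 : ℝ) :=
            mul_le_mul_of_nonneg_left (hstep k) (by rw [e1]; positivity)
        _ = d k ^ 6 * (d k * Y k) ^ (6/5 : ℝ) := by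
            rw [e1, e2, show d k * (5/6) ^ 5 * Y k = (5/6:ℝ) ^ 5 * (d k * Y k) by ring,
              Real.mul_rpow (by positivity) (by positivity), h6 _ (by norm_num)]
            ring
        _ = (d k ^ 6 * Y k) ^ (6/5 : ℝ) := by
            rw [show d k ^ 6 * Y k = d k ^ 5 * (d k * Y k) by ring,
              Real.mul_rpow (x := d k ^ 5) (y := d k * Y k) (by positivity) (by positivity), h6 _ hdk0]
        _ ≤ (N ^ (((6:ℝ)/5) ^ k)) ^ (6/5 : ℝ) := by gcongr
        _ = _ := by rw [← Real.rpow_mul hN0, pow_succ]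
  intro k
  refine le_trans ?_ (main k)
  exact le_mul_of_one_le_left (hY k) (one_le_pow₀ (hd1 k))

lemma sup_bound {n : ℕ} {Ω : Set (EuclideanSpace ℝ (Fin n))} (hΩ : GoodDomain Ω)
    {S : EuclideanSpace ℝ (Fin n) → ℝ} (hc : ContinuousOn S Ω) (hS : ∀ x ∈ Ω, 0 ≤ S x)
    {e z0 N : ℝ} (he : 0 ≤ e) (hz0 : 0 < z0) (hN : 1 ≤ N)
    (hint : ∀ k : ℕ, IntegrableOn (fun x => S x ^ (e + (6/5) ^ k * z0)) Ω)
    (h : ∀ k : ℕ, ∫ x in Ω, S x ^ (e + (6/5) ^ k * z0) ≤ N ^ (((6:ℝ)/5) ^ k)) :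
    ∀ x ∈ Ω, S x ≤ N ^ (1/z0) := by
  intro x0 hx0
  by_contra hcon
  rw [not_le] at hcon
  set B := N ^ (1/z0) with hB
  have hB1 : 1 ≤ B := Real.one_le_rpow hN (by positivity)
  obtain ⟨b, hb1, hb2⟩ := exists_between hcon
  have hU : {x | x ∈ Ω ∧ b < S x} ∈ 𝓝 x0 := by
    filter_upwards [hΩ.1.mem_nhds hx0,
      (hc.continuousAt (hΩ.1.mem_nhds hx0)).eventually_const_lt hb2] with x h1 h2
    exact ⟨h1, h2⟩
  obtain ⟨r, hr, hball⟩ := Metric.mem_nhds_iff.1 hU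
  set v := volume.real (Metric.ball x0 r)
  have hv : 0 < v := by
    refine ENNReal.toReal_pos (Metric.measure_ball_pos _ _ hr).ne' Metric.isBounded_ball.measure_lt_top.ne
  have hsub : Metric.ball x0 r ⊆ Ω := fun x hx => (hball hx).1
  have hb0 : 1 < b := by linarith
  have key : ∀ k : ℕ, ((b / B) ^ z0) ^ (((6:ℝ)/5) ^ k) * v ≤ 1 := by
    intro k
    set y := (6/5 : ℝ) ^ k
    have hy : 0 < y := by positivity
    have e1 : b ^ (e + y * z0) * v ≤ ∫ x in Ω, S x ^ (e + y * z0) := by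
      have : b ^ (e + y * z0) * v = ∫ x in Metric.ball x0 r, b ^ (e + y * z0) := by
        rw [setIntegral_const, smul_eq_mul, mul_comm]
      rw [this]
      refine le_trans (setIntegral_mono_on (integrableOn_const Metric.isBounded_ball.measure_lt_top.ne)
        ((hint k).mono_set hsub) measurableSet_ball ?_) (setIntegral_mono_set (hint k) ?_ hsub.eventuallyLE)
      · intro x hx
        have := (hball hx).2
        gcongr
      · filter_upwards [ae_restrict_mem hΩ.1.measurableSet] with x hx
        exact Real.rpow_nonneg (hS x hx) _
    have e2 : b ^ (y * z0) ≤ b ^ (e + y * z0) :=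
      Real.rpow_le_rpow_of_exponent_le hb0.le (by linarith)
    have e3 : N ^ y = B ^ (y * z0) := by
      rw [hB, ← Real.rpow_mul (by linarith)]; congr 1; field_simp
    have e4 : b ^ (y * z0) * v ≤ B ^ (y * z0) := by
      rw [← e3]
      exact (mul_le_mul_of_nonneg_right e2 hv.le).trans (e1.trans (h k))
    have hBp : 0 < B ^ (y * z0) := by positivity
    rw [← Real.rpow_mul (by positivity), mul_comm z0, Real.div_rpow (by linarith) (by linarith),
      div_mul_eq_mul_div, div_le_one hBp]
    exact e4
  set w := (b / B) ^ z0
  have hw : 1 < w := Real.one_lt_rpow ((one_lt_div (by linarith)).2 hb1) hz0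
  have ht : Tendsto (fun k : ℕ => w ^ (((6:ℝ)/5) ^ k)) atTop atTop :=
    (tendsto_rpow_atTop_of_base_gt_one w hw).comp (tendsto_pow_atTop_atTop_of_one_lt (by norm_num))
  obtain ⟨k, hk⟩ := (ht.eventually (eventually_gt_atTop (1 / v))).exists
  rw [div_lt_iff₀ hv] at hk
  linarith [key k]

/-! ### Moser iteration, application -/

/-- truncated `√(Df)` -/
def aaF (f : ℝ → ℝ) (t1 t : ℝ) : ℝ := sA f (max t t1)

/-- truncated `f / √(Df)` -/
def HF (f : ℝ → ℝ) (t1 t : ℝ) : ℝ := hh f (max t t1)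

/-- the truncation level -/
def KK (f : ℝ → ℝ) (t1 : ℝ) : ℝ := 2 * (lev f t1 + 1)

/-- the function to which the iteration is applied -/
def SF {n : ℕ} (f : ℝ → ℝ) (t1 lam : ℝ) (u : EuclideanSpace ℝ (Fin n) → ℝ)
    (x : EuclideanSpace ℝ (Fin n)) : ℝ :=
  max (max (KK f t1) (HF f t1 (u x))) (VV lam u x)

section SecI
variable {n : ℕ} {Ω : Set (EuclideanSpace ℝ (Fin n))}
variable {a : EReal} {f : ℝ → ℝ} {β κ γ t1 p : ℝ} {lam : ℝ} {u : EuclideanSpace ℝ (Fin n) → ℝ}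

lemma max_mem (h : PP a f β κ γ t1) {t : ℝ} (ht : t ∈ domf a) : max t t1 ∈ D0 a := by
  rcases max_choice t t1 with e | e
  · rw [e]; exact ⟨h.ht1.1.trans_le (e ▸ le_max_right t t1), ht.2⟩
  · rw [e]; exact h.ht1

lemma aaF_cont (h : PP a f β κ γ t1) : ContinuousOn (aaF f t1) (domf a) :=
  (sA_cd h.hf).continuousOn.comp (by fun_prop) (fun _ ht => max_mem h ht)

lemma HF_cont (h : PP a f β κ γ t1) : ContinuousOn (HF f t1) (domf a) :=
  (hh_cd h.hf).continuousOn.comp (by fun_prop) (fun _ ht => max_mem h ht)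

lemma aaF_ge (h : PP a f β κ γ t1) {t : ℝ} (ht : t ∈ domf a) : sA f t1 ≤ aaF f t1 t :=
  sA_mono h.hf h.ht1 (max_mem h ht) (le_max_right _ _)

lemma aaF_pos (h : PP a f β κ γ t1) {t : ℝ} (ht : t ∈ domf a) : 0 < aaF f t1 t :=
  sA_pos h.hf (max_mem h ht)

lemma HF_pos (h : PP a f β κ γ t1) {t : ℝ} (ht : t ∈ domf a) : 0 < HF f t1 t :=
  hh_pos h.hf (max_mem h ht)

lemma f_le_aaF (h : PP a f β κ γ t1) {t : ℝ} (ht : t ∈ domf a) :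
    f t ≤ aaF f t1 t * HF f t1 t := by
  have := f_eq h.hf (max_mem h ht)
  unfold aaF HF
  rw [← this]
  exact h.hf.mono.monotoneOn ht (D0_sub _ (max_mem h ht)) (le_max_left _ _)

lemma theta_eq {t : ℝ} : theta f t1 p t = chi p (lev f t1) (HF f t1 t) := by
  unfold theta HF
  split_ifs with hc
  · rw [max_eq_right hc, chi_zero]; unfold lev; linarith
  · rw [max_eq_left (not_le.1 hc).le]

lemma ThetaE_le' (h : PP a f β κ γ t1) (hp : 1 ≤ p) {t : ℝ} (ht : t ∈ domf a) :
    ThetaE f t1 p t ≤ p * (HF f t1 t ^ (2 * p - 1) * aaF f t1 t) := by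
  have h1 := HF_pos h ht
  have h2 := aaF_pos h ht
  rcases le_or_gt t t1 with hc | hc
  · rw [ThetaE_zero h hc]; positivity
  · have := ThetaE_le_gen h hp t ⟨h.ht1.1.trans hc, ht.2⟩ hc.le
    simpa only [HF, aaF, max_eq_left hc.le] using this

lemma KK_pos (h : PP a f β κ γ t1) : 0 < KK f t1 := by
  have := lev_pos h
  unfold KK; linarith

lemma SF_ge_K (x) : KK f t1 ≤ SF f t1 lam u x := (le_max_left _ _).trans (le_max_left _ _)
lemma SF_ge_H (x) : HF f t1 (u x) ≤ SF f t1 lam u x := (le_max_right _ _).trans (le_max_left _ _)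
lemma SF_ge_V (x) : VV lam u x ≤ SF f t1 lam u x := le_max_right _ _
lemma SF_pos (h : PP a f β κ γ t1) (x) : 0 < SF f t1 lam u x := (KK_pos h).trans_le (SF_ge_K x)

lemma SF_cases (h : PP a f β κ γ t1) (hp : 1 ≤ p) (x) :
    SF f t1 lam u x ^ p = KK f t1 ^ p ∨ SF f t1 lam u x ^ p ≤ 2 * theta f t1 p (u x) ∨
      SF f t1 lam u x ^ p ≤ 2 * chi p (lev f t1) (VV lam u x) := by
  have hl := lev_pos h
  have hK := SF_ge_K (f := f) (t1 := t1) (lam := lam) (u := u) x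
  rcases max_choice (max (KK f t1) (HF f t1 (u x))) (VV lam u x) with e | e
  · rcases max_choice (KK f t1) (HF f t1 (u x)) with e' | e'
    · left; rw [SF, e, e']
    · right; left
      have e2 : SF f t1 lam u x = HF f t1 (u x) := by rw [SF, e, e']
      rw [e2, theta_eq]; rw [e2] at hK
      exact chi_half hl hp hK
  · right; right
    have e2 : SF f t1 lam u x = VV lam u x := e
    rw [e2]; rw [e2] at hK
    exact chi_half hl hp hK

lemma SF_BM (hΩ : GoodDomain Ω) (h : PP a f β κ γ t1) (hs : Solves Ω a lam f u) :
    BM Ω (SF f t1 lam u) :=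
  ((BM.const _).max (.of_u hΩ h.hf.a_pos hs (HF_cont h))).max
    (.of_continuous hΩ (VV_cd hs.1).continuous)

lemma SF_cont (h : PP a f β κ γ t1) (hs : Solves Ω a lam f u) :
    ContinuousOn (SF f t1 lam u) Ω := by
  have h1 : ContinuousOn (fun x => HF f t1 (u x)) Ω :=
    (HF_cont h).comp hs.1.continuous.continuousOn (fun x hx => hs.2.1 x hx)
  exact (continuousOn_const.sup h1).sup (VV_cd hs.1).continuous.continuousOn

lemma BM.rpow {g : EuclideanSpace ℝ (Fin n) → ℝ} (hg : BM Ω g) {q : ℝ} (hq : 0 ≤ q) :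
    BM Ω (fun x => g x ^ q) := hg.comp (Real.continuous_rpow_const hq)

lemma vol_pos (hΩ : GoodDomain Ω) : 0 < volume.real Ω :=
  ENNReal.toReal_pos (hΩ.1.measure_pos _ hΩ.2.2).ne' hΩ.2.1.measure_lt_top.ne

lemma moser_step (hn1 : 1 ≤ n) (hn : n ≤ 12) (hΩ : GoodDomain Ω) (h : PP a f β κ γ t1) :
    ∃ C : ℝ, 0 < C ∧ ∀ (lam : ℝ) (u : EuclideanSpace ℝ (Fin n) → ℝ), 0 < lam →
      Solves Ω a lam f u → StabIneq Ω lam f u → ∀ p : ℝ, 1 ≤ p →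
      ∫ x in Ω, SF f t1 lam u x ^ (12/5 * p) ≤
        (C * p * ∫ x in Ω, aaF f t1 (u x) * SF f t1 lam u x ^ (2 * p)) ^ (6/5 : ℝ) := by
  have hl := lev_pos h
  have hf := h.hf
  obtain ⟨M, hM, hMb⟩ := mu_bound hn1 hΩ hf
  obtain ⟨Cs, hCs, hS⟩ := sob_real hn1 hn hΩ.2.1 hΩ.1.measurableSet
  have hv := vol_pos hΩ
  set v := volume.real Ω
  have ha1 := sA_pos hf h.ht1
  set a1 := sA f t1
  have hK := KK_pos h
  set K := KK f t1 with hKdef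
  set c3 := (1 + v) / (a1 * v)
  have hc3 : 0 < c3 := by positivity
  have hm := hΩ.1.measurableSet
  refine ⟨3 * (c3 + 4 * (Cs * M)), by positivity, fun lam u hlam hs hst p hp => ?_⟩
  have hμM := hMb lam u hlam hs hst
  have hμ := Real.sqrt_pos.2 hlam
  have hV0 := VV_nonneg hΩ hlam hf hs
  have bV : BM Ω (VV lam u) := .of_continuous hΩ (VV_cd hs.1).continuous
  have bχ : BM Ω (fun x => chi p (lev f t1) (VV lam u x)) := bV.comp (chi_cd hl).continuous
  have bE : BM Ω (fun x => chiE p (lev f t1) (VV lam u x)) := bV.comp (chiE_prim hl).2.continuous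
  have bf : BM Ω (fun x => f (u x)) := .of_u hΩ hf.a_pos hs hf.smooth.continuousOn
  have bθ : BM Ω (fun x => theta f t1 p (u x)) :=
    .of_u hΩ hf.a_pos hs ((theta_cd h).continuousOn.mono domf_sub_Dm)
  have bΘ : BM Ω (fun x => ThetaE f t1 p (u x)) :=
    .of_u hΩ hf.a_pos hs ((ThetaE_prim h).2.continuousOn.mono domf_sub_Dm)
  have ba : BM Ω (fun x => aaF f t1 (u x)) := .of_u hΩ hf.a_pos hs (aaF_cont h)
  have bS := SF_BM hΩ h hs
  have bZ := ba.mul (bS.rpow (q := 2 * p) (by linarith))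
  have hS0 : ∀ x, 0 < SF f t1 lam u x := fun x => SF_pos h x
  set Z := ∫ x in Ω, aaF f t1 (u x) * SF f t1 lam u x ^ (2 * p) with hZ
  have hZlow : a1 * K ^ (2 * p) * v ≤ Z := by
    have : a1 * K ^ (2 * p) * v = ∫ x in Ω, a1 * K ^ (2 * p) := by
      rw [setIntegral_const, smul_eq_mul, mul_comm]
    rw [this]
    refine setIntegral_mono_on ((BM.const _).int hΩ) (bZ.int hΩ) hm fun x hx => ?_
    have := aaF_ge h (hs.2.1 x hx)
    have := SF_ge_K (f := f) (t1 := t1) (lam := lam) (u := u) x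
    gcongr
    exact ha1.le.trans (by assumption)
  have hZ0 : 0 < Z := lt_of_lt_of_le (by positivity) hZlow
  have hsplit : ∀ s : ℝ, 0 < s → s ^ (2 * p) = s ^ (2 * p - 1) * s := fun s hs => by
    conv_rhs => rw [← Real.rpow_one s, ← Real.rpow_mul hs.le, ← Real.rpow_add hs]
    congr 1; ring
  have hJE : ∫ x in Ω, chiE p (lev f t1) (VV lam u x) * f (u x) ≤ p * Z := by
    rw [hZ, ← integral_const_mul]
    refine setIntegral_mono_on ((bE.mul bf).int hΩ) ((bZ.cmul p).int hΩ) hm fun x hx => ?_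
    have h1 := chiE_le hl hp (hV0 x hx)
    have h2 := f_le_aaF h (hs.2.1 x hx)
    have h3 := aaF_pos h (hs.2.1 x hx)
    have h4 := hV0 x hx
    have h5 : p ^ 2 / (2 * p - 1) ≤ p := by rw [div_le_iff₀ (by linarith)]; nlinarith
    have h6 := hf.pos _ (hs.2.1 x hx)
    have h7 := SF_ge_V (f := f) (t1 := t1) (lam := lam) (u := u) x
    have h8 := SF_ge_H (f := f) (t1 := t1) (lam := lam) (u := u) x
    have h9 := hS0 x
    have h10 : (0:ℝ) ≤ 2 * p - 1 := by linarith
    calc chiE p (lev f t1) (VV lam u x) * f (u x)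
        ≤ (p * SF f t1 lam u x ^ (2 * p - 1)) * (aaF f t1 (u x) * SF f t1 lam u x) := by
          apply mul_le_mul _ (h2.trans (by gcongr)) h6.le (by positivity)
          exact h1.trans (mul_le_mul h5 (Real.rpow_le_rpow h4 h7 h10) (by positivity) (by linarith))
      _ = _ := by rw [hsplit _ h9]; ring
  have hJT : ∫ x in Ω, ThetaE f t1 p (u x) * VV lam u x ≤ p * Z := by
    rw [hZ, ← integral_const_mul]
    refine setIntegral_mono_on ((bΘ.mul bV).int hΩ) ((bZ.cmul p).int hΩ) hm fun x hx => ?_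
    have h1 := ThetaE_le' h hp (hs.2.1 x hx)
    have h2 := HF_pos h (hs.2.1 x hx)
    have h3 := aaF_pos h (hs.2.1 x hx)
    have h4 := hV0 x hx
    have h7 := SF_ge_V (f := f) (t1 := t1) (lam := lam) (u := u) x
    have h8 := SF_ge_H (f := f) (t1 := t1) (lam := lam) (u := u) x
    have h9 := hS0 x
    have h10 : (0:ℝ) ≤ 2 * p - 1 := by linarith
    have h11 := Real.rpow_le_rpow h2.le h8 h10
    calc ThetaE f t1 p (u x) * VV lam u x
        ≤ (p * (SF f t1 lam u x ^ (2 * p - 1) * aaF f t1 (u x))) * SF f t1 lam u x := by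
          apply mul_le_mul _ h7 h4 (by positivity)
          exact h1.trans (by gcongr)
      _ = _ := by rw [hsplit _ h9]; ring
  obtain ⟨φ, q1, q2, q3, q4, q5⟩ := energy_V hΩ hlam h hs p
  obtain ⟨ψ, r1, r2, r3, r4, r5⟩ := energy_H hΩ hlam h hs p
  have s1 := hS φ q1 q2 q3
  have s2 := hS ψ r1 r2 r3
  rw [q5, setIntegral_congr_fun hm (g := fun x => chi p (lev f t1) (VV lam u x) ^ (12/5 : ℝ))
    (fun x hx => by simp only [q4 x hx, abs_of_nonneg (chi_nonneg hl hp _)])] at s1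
  have hθ0 : ∀ t, 0 ≤ theta f t1 p t := fun t => by rw [theta_eq]; exact chi_nonneg hl hp _
  rw [r5, setIntegral_congr_fun hm (g := fun x => theta f t1 p (u x) ^ (12/5 : ℝ))
    (fun x hx => by simp only [r4 x hx, abs_of_nonneg (hθ0 _)])] at s2
  set I1 := ∫ x in Ω, chi p (lev f t1) (VV lam u x) ^ (12/5 : ℝ)
  set I2 := ∫ x in Ω, theta f t1 p (u x) ^ (12/5 : ℝ)
  have hJ1 : 0 ≤ ∫ x in Ω, chiE p (lev f t1) (VV lam u x) * f (u x) :=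
    setIntegral_nonneg hm fun x hx => mul_nonneg (chiE_nonneg hl _) (hf.pos _ (hs.2.1 x hx)).le
  have hJ2 : 0 ≤ ∫ x in Ω, ThetaE f t1 p (u x) * VV lam u x := by
    have : 0 ≤ Real.sqrt lam * ∫ x in Ω, ThetaE f t1 p (u x) * VV lam u x := by
      rw [← r5]; exact integral_nonneg fun x => by positivity
    exact nonneg_of_mul_nonneg_right this hμ
  have four : (2:ℝ) ^ (12/5 : ℝ) = 4 ^ (6/5 : ℝ) := by
    rw [show (4:ℝ) = 2 ^ (2:ℝ) by norm_num, ← Real.rpow_mul (by norm_num)]; norm_num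
  set W := (c3 + 4 * (Cs * M)) * p * Z with hW
  have hp0 : 0 < p := by linarith
  have ww1 : 2 ^ (12/5 : ℝ) * I1 ≤ W ^ (6/5 : ℝ) := by
    rw [four]
    refine (mul_le_mul_of_nonneg_left s1 (by positivity)).trans ?_
    rw [← Real.mul_rpow (by norm_num) (by positivity)]
    apply Real.rpow_le_rpow (by positivity) _ (by norm_num)
    calc 4 * (Cs * (Real.sqrt lam * ∫ x in Ω, chiE p (lev f t1) (VV lam u x) * f (u x)))
        ≤ 4 * (Cs * (M * (p * Z))) := by gcongr
      _ ≤ W := by rw [hW]; nlinarith [mul_pos hc3 (mul_pos hp0 hZ0)]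
  have ww2 : 2 ^ (12/5 : ℝ) * I2 ≤ W ^ (6/5 : ℝ) := by
    rw [four]
    refine (mul_le_mul_of_nonneg_left s2 (by positivity)).trans ?_
    rw [← Real.mul_rpow (by norm_num) (by positivity)]
    apply Real.rpow_le_rpow (by positivity) _ (by norm_num)
    calc 4 * (Cs * (Real.sqrt lam * ∫ x in Ω, ThetaE f t1 p (u x) * VV lam u x))
        ≤ 4 * (Cs * (M * (p * Z))) := by gcongr
      _ ≤ W := by rw [hW]; nlinarith [mul_pos hc3 (mul_pos hp0 hZ0)]
  have ww3 : K ^ (12/5 * p) * v ≤ W ^ (6/5 : ℝ) := by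
    have e1 : (1 + v) * K ^ (2 * p) ≤ W := by
      calc (1 + v) * K ^ (2 * p) = c3 * (a1 * K ^ (2 * p) * v) := by
            simp only [c3]; field_simp
        _ ≤ c3 * Z := by gcongr
        _ ≤ c3 * p * Z := by nlinarith [mul_pos hc3 hZ0]
        _ ≤ W := by rw [hW]; gcongr; have : 0 < Cs * M := by positivity
                    linarith
    calc K ^ (12/5 * p) * v ≤ K ^ (12/5 * p) * (1 + v) ^ (6/5 : ℝ) := by
          gcongr
          calc v ≤ (1 + v) ^ (1:ℝ) := by rw [Real.rpow_one]; linarith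
            _ ≤ _ := Real.rpow_le_rpow_of_exponent_le (by linarith) (by norm_num)
      _ = ((1 + v) * K ^ (2 * p)) ^ (6/5 : ℝ) := by
          rw [Real.mul_rpow (by positivity) (by positivity), ← Real.rpow_mul hK.le, mul_comm]
          congr 2; ring
      _ ≤ _ := by gcongr
  have hW0 : 0 < W := by positivity
  have b1 := (bθ.rpow (q := 12/5) (by norm_num)).cmul (2 ^ (12/5 : ℝ))
  have b2 := (bχ.rpow (q := 12/5) (by norm_num)).cmul (2 ^ (12/5 : ℝ))
  have e0 : ∫ x in Ω, SF f t1 lam u x ^ (12/5 * p) ≤ K ^ (12/5 * p) * v + 2 ^ (12/5 : ℝ) * I2 +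
      2 ^ (12/5 : ℝ) * I1 := by
    have e : K ^ (12/5 * p) * v + 2 ^ (12/5 : ℝ) * I2 + 2 ^ (12/5 : ℝ) * I1 =
      ∫ x in Ω, (K ^ (12/5 * p) + 2 ^ (12/5 : ℝ) * theta f t1 p (u x) ^ (12/5 : ℝ) +
        2 ^ (12/5 : ℝ) * chi p (lev f t1) (VV lam u x) ^ (12/5 : ℝ)) := by
      rw [integral_add (((BM.const _).add b1).int hΩ) (b2.int hΩ),
        integral_add ((BM.const _).int hΩ) (b1.int hΩ), integral_const_mul, integral_const_mul,
        setIntegral_const, smul_eq_mul, mul_comm v]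
    rw [e]
    refine setIntegral_mono_on ((bS.rpow (by positivity)).int hΩ)
      ((((BM.const _).add b1).add b2).int hΩ) hm fun x hx => ?_
    have f1 := hθ0 (u x)
    have f2 : 0 ≤ chi p (lev f t1) (VV lam u x) := chi_nonneg hl hp _
    have f3 : 0 ≤ K ^ (12/5 * p) := by positivity
    have f4 := Real.rpow_nonneg f1 (12/5)
    have f5 := Real.rpow_nonneg f2 (12/5)
    have f6 : (0:ℝ) ≤ 2 ^ (12/5 : ℝ) := by positivity
    have f7 := mul_nonneg f6 f4
    have f8 := mul_nonneg f6 f5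
    have f9 := (Real.rpow_pos_of_pos (hS0 x) p).le
    rw [mul_comm (12/5) p, Real.rpow_mul (hS0 x).le]
    rw [mul_comm (12/5) p, Real.rpow_mul hK.le] at f3
    rw [Real.rpow_mul hK.le]
    rcases SF_cases (lam := lam) (u := u) h hp x with c | c | c
    · rw [c, ← hKdef]; linarith
    · have := Real.rpow_le_rpow f9 c (show (0:ℝ) ≤ 12/5 by norm_num)
      rw [Real.mul_rpow (by norm_num) f1] at this
      linarith
    · have := Real.rpow_le_rpow f9 c (show (0:ℝ) ≤ 12/5 by norm_num)
      rw [Real.mul_rpow (by norm_num) f2] at this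
      linarith
  calc _ ≤ _ := e0
    _ ≤ 3 * W ^ (6/5 : ℝ) := by linarith
    _ ≤ 3 ^ (6/5 : ℝ) * W ^ (6/5 : ℝ) := by
        gcongr
        calc (3:ℝ) = 3 ^ (1:ℝ) := by rw [Real.rpow_one]
          _ ≤ _ := Real.rpow_le_rpow_of_exponent_le (by norm_num) (by norm_num)
    _ = _ := by rw [← Real.mul_rpow (by norm_num) hW0.le, hW]; congr 1; ring
end SecI

section SecJ
variable {n : ℕ} {Ω : Set (EuclideanSpace ℝ (Fin n))}
variable {a : EReal} {f : ℝ → ℝ} {β κ γ t1 p : ℝ} {lam : ℝ} {u : EuclideanSpace ℝ (Fin n) → ℝ}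

lemma base_bound (hn1 : 1 ≤ n) (hn : n ≤ 12) (hΩ : GoodDomain Ω) (h : PP a f β κ γ t1) :
    ∃ C : ℝ, ∀ (lam : ℝ) (u : EuclideanSpace ℝ (Fin n) → ℝ), 0 < lam →
      Solves Ω a lam f u → StabIneq Ω lam f u →
      ∫ x in Ω, aaF f t1 (u x) * SF f t1 lam u x ^ (2 * β) ≤ C := by
  have hl := lev_pos h
  have hf := h.hf
  have hβ := h.hβ
  have ha1 := sA_pos hf h.ht1
  have hK := KK_pos h
  obtain ⟨C1, hC1⟩ := stage1 hn1 hn hΩ h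
  obtain ⟨C2, hC2, habs⟩ := sA_absorb h (c := KK f t1 ^ (2 * β)) (ε := 1) (by positivity) one_pos
  have hm := hΩ.1.measurableSet
  refine ⟨5 * C1 + 4 * C1 + 4 * sA f t1 * C1 + (C2 + sA f t1 * KK f t1 ^ (2 * β)) * volume.real Ω,
    fun lam u hlam hs hst => ?_⟩
  obtain ⟨i1, i2, i3⟩ := hC1 lam u hlam hs hst
  have bV : BM Ω (VV lam u) := .of_continuous hΩ (VV_cd hs.1).continuous
  have bχ : BM Ω (fun x => chi β (lev f t1) (VV lam u x)) := bV.comp (chi_cd hl).continuous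
  have bθ : BM Ω (fun x => theta f t1 β (u x)) :=
    .of_u hΩ hf.a_pos hs ((theta_cd h).continuousOn.mono domf_sub_Dm)
  have ba : BM Ω (fun x => aaF f t1 (u x)) := .of_u hΩ hf.a_pos hs (aaF_cont h)
  have bA := BM.sA hΩ hf hs
  have bS := SF_BM hΩ h hs
  have b1 := (bA.mul bθ.sq).cmul 5
  have b2 := (bA.mul bχ.sq).cmul 4
  have b3 := bχ.sq.cmul (4 * sA f t1)
  have b4 : BM Ω (fun _ => C2 + sA f t1 * KK f t1 ^ (2 * β)) := BM.const _
  have hS0 : ∀ x, 0 < SF f t1 lam u x := fun x => SF_pos h x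
  calc ∫ x in Ω, aaF f t1 (u x) * SF f t1 lam u x ^ (2 * β)
      ≤ ∫ x in Ω, (5 * (sA f (u x) * theta f t1 β (u x) ^ 2) +
          4 * (sA f (u x) * chi β (lev f t1) (VV lam u x) ^ 2) +
          4 * sA f t1 * chi β (lev f t1) (VV lam u x) ^ 2 +
          (C2 + sA f t1 * KK f t1 ^ (2 * β))) := by
        refine setIntegral_mono_on ((ba.mul (bS.rpow (by linarith))).int hΩ)
          ((((b1.add b2).add b3).add b4).int hΩ) hm fun x hx => ?_
        have hA0 : 0 ≤ sA f (u x) := Real.sqrt_nonneg _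
        have haa := aaF_pos h (hs.2.1 x hx)
        have hθ0 : 0 ≤ theta f t1 β (u x) := by rw [theta_eq]; exact chi_nonneg hl hβ.le _
        have hχ0 : 0 ≤ chi β (lev f t1) (VV lam u x) := chi_nonneg hl hβ.le _
        have p2 : ∀ s : ℝ, 0 < s → s ^ (2 * β) = (s ^ β) ^ 2 := fun s hs => by
          rw [← Real.rpow_natCast, ← Real.rpow_mul hs.le, mul_comm 2 β]; norm_num
        have hSp := (Real.rpow_pos_of_pos (hS0 x) β).le
        have hKp : 0 < KK f t1 ^ (2 * β) := by positivity
        have k1 : SF f t1 lam u x ^ (2 * β) ≤ KK f t1 ^ (2 * β) + 4 * theta f t1 β (u x) ^ 2 +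
            4 * chi β (lev f t1) (VV lam u x) ^ 2 := by
          have z1 := sq_nonneg (theta f t1 β (u x))
          have z2 := sq_nonneg (chi β (lev f t1) (VV lam u x))
          have z3 := sq_nonneg (KK f t1 ^ β)
          rw [p2 _ (hS0 x), p2 _ hK]
          rcases SF_cases (lam := lam) (u := u) h hβ.le x with c | c | c
          · rw [c]; linarith
          · have := pow_le_pow_left₀ hSp c 2
            rw [mul_pow] at this; linarith
          · have := pow_le_pow_left₀ hSp c 2
            rw [mul_pow] at this; linarith
        have k2 := mul_le_mul_of_nonneg_left k1 haa.le
        have z1 := mul_nonneg hA0 (sq_nonneg (theta f t1 β (u x)))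
        have z2 := mul_nonneg hA0 (sq_nonneg (chi β (lev f t1) (VV lam u x)))
        have z3 := mul_nonneg ha1.le (sq_nonneg (chi β (lev f t1) (VV lam u x)))
        have z4 := mul_pos ha1 hKp
        rcases le_or_gt (u x) t1 with hc | hc
        · have e1 : aaF f t1 (u x) = sA f t1 := by rw [aaF, max_eq_right hc]
          have e2 : theta f t1 β (u x) = 0 := theta_zero hc
          rw [e1, e2] at k2
          rw [e1, e2]
          nlinarith
        · have e1 : aaF f t1 (u x) = sA f (u x) := by rw [aaF, max_eq_left hc.le]
          have k3 := habs (u x) ⟨h.ht1.1.trans hc, (hs.2.1 x hx).2⟩ hc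
          rw [e1] at k2
          rw [e1]
          nlinarith
    _ = 5 * (∫ x in Ω, sA f (u x) * theta f t1 β (u x) ^ 2) +
          4 * (∫ x in Ω, sA f (u x) * chi β (lev f t1) (VV lam u x) ^ 2) +
          4 * sA f t1 * (∫ x in Ω, chi β (lev f t1) (VV lam u x) ^ 2) +
          (C2 + sA f t1 * KK f t1 ^ (2 * β)) * volume.real Ω := by
        rw [integral_add (((b1.add b2).add b3).int hΩ) (b4.int hΩ),
          integral_add ((b1.add b2).int hΩ) (b3.int hΩ), integral_add (b1.int hΩ) (b2.int hΩ),
          integral_const_mul, integral_const_mul, integral_const_mul, setIntegral_const, smul_eq_mul,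
          mul_comm (volume.real Ω)]
    _ ≤ _ := by gcongr

lemma final_bound (hn1 : 1 ≤ n) (hn : n ≤ 12) (hΩ : GoodDomain Ω) (h : PP a f β κ γ t1) :
    ∃ T ∈ D0 a, ∀ (lam : ℝ) (u : EuclideanSpace ℝ (Fin n) → ℝ), 0 < lam →
      Solves Ω a lam f u → StabIneq Ω lam f u → ∀ x ∈ Ω, u x ≤ T := by
  have hβ := h.hβ
  have hγ := h.hγ
  have hγβ := h.hγβ
  obtain ⟨Cb, hCb⟩ := base_bound hn1 hn hΩ h
  obtain ⟨Cm, hCm, hmos⟩ := moser_step hn1 hn hΩ h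
  obtain ⟨C1, hC1, hsA⟩ := sA_le h
  set z0 := 12/5 * β - 6 * γ with hz0
  have hz0p : 0 < z0 := by rw [hz0]; linarith
  set c := max 1 (Cm * C1 * ((5 * γ + z0) / 2))
  have hc1 : 1 ≤ c := le_max_left _ _
  have hc2 : Cm * C1 * ((5 * γ + z0) / 2) ≤ c := le_max_right _ _
  set C0 := (Cm * β * Cb) ^ (6/5 : ℝ)
  set N := max 1 ((c * (6/5) ^ 5) ^ 6 * C0)
  have hN1 : 1 ≤ N := le_max_left _ _
  obtain ⟨t2, ht2, hlarge⟩ := hh_large h (N ^ (1/z0))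
  refine ⟨t2, ht2, fun lam u hlam hs hst => ?_⟩
  have hm := hΩ.1.measurableSet
  have bS := SF_BM hΩ h hs
  have ba : BM Ω (fun x => aaF f t1 (u x)) := .of_u hΩ h.hf.a_pos hs (aaF_cont h)
  have hS0 : ∀ x, 0 < SF f t1 lam u x := fun x => SF_pos h x
  set Y : ℕ → ℝ := fun k => ∫ x in Ω, SF f t1 lam u x ^ (6 * γ + (6/5) ^ k * z0) with hY
  have hzk : ∀ k : ℕ, z0 ≤ (6/5) ^ k * z0 := fun k =>
    le_mul_of_one_le_left hz0p.le (one_le_pow₀ (by norm_num))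
  have hYint : ∀ k : ℕ, IntegrableOn (fun x => SF f t1 lam u x ^ (6 * γ + (6/5) ^ k * z0)) Ω :=
    fun k => (bS.rpow (by have := hzk k; linarith)).int hΩ
  have hY0 : ∀ k, 0 ≤ Y k := fun k =>
    setIntegral_nonneg hm fun x _ => Real.rpow_nonneg (hS0 x).le _
  have hstep : ∀ k, Y (k + 1) ≤ (c * (6/5) ^ k * Y k) ^ (6/5 : ℝ) := by
    intro k
    have hz := hzk k
    have hk1 : (1:ℝ) ≤ (6/5) ^ k := one_le_pow₀ (by norm_num)
    set p := (5 * γ + (6/5) ^ k * z0) / 2 with hp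
    have hp1 : 1 ≤ p := by rw [hp]; linarith
    have hp0 : 0 < p := by linarith
    have e1 := hmos lam u hlam hs hst p hp1
    have e2 : 12/5 * p = 6 * γ + (6/5) ^ (k+1) * z0 := by rw [hp, pow_succ]; ring
    rw [e2] at e1
    have hZ0 : 0 ≤ ∫ x in Ω, aaF f t1 (u x) * SF f t1 lam u x ^ (2 * p) :=
      setIntegral_nonneg hm fun x hx =>
        mul_nonneg (aaF_pos h (hs.2.1 x hx)).le (Real.rpow_nonneg (hS0 x).le _)
    have e3 : ∫ x in Ω, aaF f t1 (u x) * SF f t1 lam u x ^ (2 * p) ≤ C1 * Y k := by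
      rw [hY]; simp only; rw [← integral_const_mul]
      refine setIntegral_mono_on ((ba.mul (bS.rpow (by linarith))).int hΩ)
        ((hYint k).const_mul C1) hm fun x hx => ?_
      have g1 : aaF f t1 (u x) ≤ C1 * HF f t1 (u x) ^ γ :=
        hsA _ (max_mem h (hs.2.1 x hx)) (le_max_right _ _)
      have g2 : HF f t1 (u x) ^ γ ≤ SF f t1 lam u x ^ γ :=
        Real.rpow_le_rpow (HF_pos h (hs.2.1 x hx)).le (SF_ge_H x) hγ.le
      have g3 := Real.rpow_nonneg (hS0 x).le (2 * p)
      calc aaF f t1 (u x) * SF f t1 lam u x ^ (2 * p)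
          ≤ (C1 * SF f t1 lam u x ^ γ) * SF f t1 lam u x ^ (2 * p) :=
            mul_le_mul_of_nonneg_right (g1.trans (mul_le_mul_of_nonneg_left g2 hC1.le)) g3
        _ = _ := by
            rw [mul_assoc, ← Real.rpow_add (hS0 x)]; congr 2; rw [hp]; ring
    refine e1.trans (Real.rpow_le_rpow (by positivity) ?_ (by norm_num))
    have hpk : p ≤ (5 * γ + z0) / 2 * (6/5) ^ k := by rw [hp]; nlinarith
    calc Cm * p * ∫ x in Ω, aaF f t1 (u x) * SF f t1 lam u x ^ (2 * p)
        ≤ Cm * ((5 * γ + z0) / 2 * (6/5) ^ k) * (C1 * Y k) := by gcongr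
      _ = (Cm * C1 * ((5 * γ + z0) / 2)) * (6/5) ^ k * Y k := by ring
      _ ≤ c * (6/5) ^ k * Y k := by
          have := hY0 k
          gcongr
  have hYz : Y 0 ≤ C0 := by
    have e1 := hmos lam u hlam hs hst β hβ.le
    have e2 : Y 0 = ∫ x in Ω, SF f t1 lam u x ^ (12/5 * β) := by
      simp only [hY, pow_zero, one_mul, hz0]
      congr 1; funext x; congr 1; ring
    rw [e2]
    have hZ0 : 0 ≤ ∫ x in Ω, aaF f t1 (u x) * SF f t1 lam u x ^ (2 * β) :=
      setIntegral_nonneg hm fun x hx =>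
        mul_nonneg (aaF_pos h (hs.2.1 x hx)).le (Real.rpow_nonneg (hS0 x).le _)
    have hb0 : 0 < β := by linarith
    refine e1.trans (Real.rpow_le_rpow (by positivity) ?_ (by norm_num))
    exact mul_le_mul_of_nonneg_left (hCb lam u hlam hs hst) (by positivity)
  have hNN : (c * (6/5) ^ 5) ^ 6 * Y 0 ≤ N :=
    (mul_le_mul_of_nonneg_left hYz (by positivity)).trans (le_max_right _ _)
  have hfin := sup_bound hΩ (SF_cont h hs) (fun x _ => (hS0 x).le) (e := 6 * γ) (by positivity)
    hz0p hN1 hYint (iter_bound hc1 hY0 hstep hNN)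
  intro x hx
  by_contra hcon
  rw [not_le] at hcon
  have hmm := hlarge _ (max_mem h (hs.2.1 x hx)) (hcon.le.trans (le_max_left _ _))
  have := (SF_ge_H (f := f) (t1 := t1) (lam := lam) (u := u) x).trans (hfin x hx)
  exact absurd hmm (not_lt.2 this)
end SecJ

lemma main_thm {n : ℕ} (hn : n ≤ 12) (Ω : Set (EuclideanSpace ℝ (Fin n)))
    (hΩ : GoodDomain Ω) (a : EReal) (f : ℝ → ℝ) (hf : HypH a f)
    (heq : tauMinus a f = tauPlus a f) (hτ0 : 0 < tauPlus a f) (hτ1 : tauPlus a f ≤ 1)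
    (lam : ℕ → ℝ) (hlam : ∀ m, 0 < lam m)
    (u : ℕ → EuclideanSpace ℝ (Fin n) → ℝ)
    (hsol : ∀ m, Solves Ω a (lam m) f (u m))
    (hstab : ∀ m, StabIneq Ω (lam m) f (u m)) :
    ∃ C : ℝ, (C : EReal) < a ∧ ∀ m, ∀ x ∈ Ω, u m x ≤ C := by
  rcases Nat.eq_zero_or_pos n with rfl | hn1
  · exfalso
    obtain ⟨x, hx⟩ := hΩ.2.2
    have h1 := (hsol 0).2.2.1 x hx
    have h2 := mul_pos (hlam 0) (hf.pos _ ((hsol 0).2.1 x hx))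
    have h3 : lap (lap (u 0)) x = 0 := by simp [lap]
    linarith
  · obtain ⟨β, κ, γ, t1, p1, p2, p3, p4, p5, p6, p7⟩ := params hf heq hτ0 hτ1
    have h : PP a f β κ γ t1 := ⟨hf, p1, p2, p3, p4, p5, p6, fun t ht htt => (p7 t ht htt).1,
      fun t ht htt => (p7 t ht htt).2.1, fun t ht htt => (p7 t ht htt).2.2⟩
    obtain ⟨T, hT, hb⟩ := final_bound hn1 hn hΩ h
    exact ⟨T, hT.2, fun m => hb _ _ (hlam m) (hsol m) (hstab m)⟩

/-- If `f` satisfies (H) with `τ₋ = τ₊ =: τ` and `0 < τ ≤ 1`, and `n ≤ 12`, then any sequence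
of semistable solutions of `(N_{λ_m})` satisfying the stability inequality is uniformly
bounded away from `a_f` in `L^∞(Ω)`. -/
theorem statement1 {n : ℕ} (hn : n ≤ 12) (Ω : Set (EuclideanSpace ℝ (Fin n)))
    (hΩ : GoodDomain Ω) (a : EReal) (f : ℝ → ℝ) (hf : HypH a f)
    (heq : tauMinus a f = tauPlus a f) (hτ0 : 0 < tauPlus a f) (hτ1 : tauPlus a f ≤ 1)
    (lam : ℕ → ℝ) (hlam : ∀ m, 0 < lam m)
    (u : ℕ → EuclideanSpace ℝ (Fin n) → ℝ)
    (hsol : ∀ m, Solves Ω a (lam m) f (u m))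
    (hsemi : ∀ m, Semistable Ω (lam m) f (u m))
    (hstab : ∀ m, StabIneq Ω (lam m) f (u m)) :
    ∃ C : ℝ, (C : EReal) < a ∧ ∀ m, ∀ x ∈ Ω, u m x ≤ C := by
  exact main_thm hn Ω hΩ a f hf heq hτ0 hτ1 lam hlam u hsol hstab

end
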